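/- arXiv:2403.11994 — 2 statements merged into one kernel-verified Lean document; each statement's English description precedes it below -/
import Mathlib

section
/- Let n ≥ 1 and let a = (a_1, ..., a_{n+1}) be a unit vector in ℝ^{n+1} with a_1 + ... + a_{n+1} = 0 and a_1 ≥ a_2 ≥ ... ≥ a_{n+1}. Set δ(a) = |a − (e_1 − e_{n+1})/√2|². Then p_a(0) ≤ 1/√2 − (1/10)·√δ(a) whenever δ(a) ≤ 1/2000, and p_a(0) ≤ 1/√2 − 2√2·10⁻⁵ whenever δ(a) > 1/2000. -/
open MeasureTheory ProbabilityTheory Real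

/-- `p` is the (continuous) probability density of `∑ⱼ aⱼ Xⱼ`, where `X₁, X₂, ...` are
i.i.d. standard exponential random variables (density `e^{-x} 1_{(0,∞)}(x)` on `ℝ`). -/
def IsExpSumDensity {m : ℕ} (a : Fin m → ℝ) (p : ℝ → ℝ) : Prop :=
  Continuous p ∧
    Measure.map (fun x : Fin m → ℝ => ∑ j, a j * x j) (Measure.pi fun _ => expMeasure 1)
      = volume.withDensity fun x => ENNReal.ofReal (p x)

section Auxiliary

open Set Filter Topology
open scoped ENNReal Nat

/-! ### The standard exponential measure -/

instance isProbabilityMeasure_expMeasure_one : IsProbabilityMeasure (expMeasure 1) :=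
  isProbabilityMeasure_expMeasure one_pos

theorem expMeasure_one_eq : expMeasure 1 =
    (volume.restrict (Ioi 0)).withDensity (fun t : ℝ => ENNReal.ofReal (exp (-t))) := by
  rw [← withDensity_indicator measurableSet_Ioi]
  refine withDensity_congr_ae ?_
  filter_upwards [(measure_singleton (0 : ℝ) : volume {(0 : ℝ)} = 0) |> compl_mem_ae_iff.2]
    with t ht
  change exponentialPDF 1 t = _
  rw [exponentialPDF_eq]
  by_cases h : 0 < t
  · simp [h, h.le]
  · have h0 : t < 0 := lt_of_le_of_ne (not_lt.1 h) ht
    simp [h, not_le.2 h0]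

theorem lintegral_expMeasure_one {g : ℝ → ℝ≥0∞} (hg : Measurable g) :
    ∫⁻ t, g t ∂expMeasure 1 = ∫⁻ t in Ioi 0, ENNReal.ofReal (exp (-t)) * g t := by
  rw [expMeasure_one_eq, lintegral_withDensity_eq_lintegral_mul _ (by fun_prop) hg]
  rfl

theorem integral_expMeasure_one (g : ℝ → ℝ) :
    ∫ t, g t ∂expMeasure 1 = ∫ t in Ioi 0, exp (-t) * g t := by
  rw [expMeasure_one_eq, integral_withDensity_eq_integral_toReal_smul (by fun_prop) (by simp)]
  simp [ENNReal.toReal_ofReal (exp_pos _).le]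

theorem integrable_expMeasure_one_iff {g : ℝ → ℝ} :
    Integrable g (expMeasure 1) ↔ IntegrableOn (fun t => exp (-t) * g t) (Ioi 0) := by
  rw [expMeasure_one_eq, integrable_withDensity_iff_integrable_smul' (by fun_prop) (by simp)]
  simp [ENNReal.toReal_ofReal (exp_pos _).le, IntegrableOn]

theorem ae_expMeasure_one_pos : ∀ᵐ t ∂expMeasure 1, (0 : ℝ) < t := by
  rw [expMeasure_one_eq]
  exact withDensity_absolutelyContinuous _ _ (ae_restrict_mem measurableSet_Ioi)

theorem integrable_pow_expMeasure_one (k : ℕ) :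
    Integrable (fun t : ℝ => t ^ k) (expMeasure 1) := by
  rw [integrable_expMeasure_one_iff]
  have h := Real.GammaIntegral_convergent (s := (k : ℝ) + 1) (by positivity)
  simpa using h

theorem integral_pow_expMeasure_one (k : ℕ) :
    ∫ t : ℝ, t ^ k ∂expMeasure 1 = k ! := by
  rw [integral_expMeasure_one, ← Real.Gamma_nat_eq_factorial, Real.Gamma_eq_integral (by positivity)]
  simp

theorem memLp_expMeasure_one {k : ℕ} (hk : k ≠ 0) :
    MemLp (fun t : ℝ => t) k (expMeasure 1) := by
  have h0 : (k : ℝ≥0∞) ≠ 0 := by exact_mod_cast hk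
  rw [← integrable_norm_rpow_iff (by fun_prop) h0 (by simp)]
  refine (integrable_pow_expMeasure_one k).congr ?_
  filter_upwards [ae_expMeasure_one_pos] with t ht
  simp [abs_of_pos ht]

theorem integral_expMeasure_one_eq_zero_of_hasDerivAt {G g : ℝ → ℝ} {τ : ℝ} (hG : Continuous G)
    (h0 : G 0 = 0) (hlim : Tendsto G atTop (𝓝 0))
    (hderiv : ∀ t, 0 < t → t ≠ τ → HasDerivAt G (exp (-t) * g t) t)
    (hg : Integrable g (expMeasure 1)) : ∫ t, g t ∂expMeasure 1 = 0 := by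
  rw [integral_expMeasure_one]
  have hi := integrable_expMeasure_one_iff.1 hg
  have h1 := intervalIntegral_tendsto_integral_Ioi 0 hi tendsto_id
  refine tendsto_nhds_unique h1 (hlim.congr' ?_)
  filter_upwards [eventually_ge_atTop 0] with R hR
  have hii : IntervalIntegrable (fun t => exp (-t) * g t) volume 0 R :=
    (intervalIntegrable_iff_integrableOn_Ioc_of_le hR).2 (hi.mono_set Ioc_subset_Ioi_self)
  have := integral_eq_of_hasDerivAt_off_countable_of_le G (fun t => exp (-t) * g t) hR
    (countable_singleton τ) hG.continuousOn
    (fun x hx => hderiv x hx.1.1 (by simpa using hx.2)) hii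
  simp [this, h0]

theorem integrable_mul_indicator_of_bounded {α : Type*} [MeasurableSpace α] {μ : Measure α}
    {g h : α → ℝ} (hg : Integrable g μ) (hh : Measurable h) (C : ℝ) (hb : ∀ x, |h x| ≤ C) :
    Integrable (fun x => g x * h x) μ :=
  hg.mul_bdd hh.aestronglyMeasurable (Eventually.of_forall hb)

theorem tendsto_mul_exp_neg_atTop : Tendsto (fun t : ℝ => t * exp (-t)) atTop (𝓝 0) := by
  simpa using tendsto_pow_mul_exp_neg_atTop_nhds_zero 1

theorem integrable_sub_one_expMeasure_one : Integrable (fun t : ℝ => t - 1) (expMeasure 1) := by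
  have := integrable_pow_expMeasure_one 1
  simp only [pow_one] at this
  exact this.sub (integrable_const 1)

/-- The one-sided function `y ↦ e^{y / a}` on `(-∞, 0)`, for `a > 0`. -/
noncomputable def expIio (a y : ℝ) : ℝ := (Iio 0).indicator (fun y => exp (y / a)) y

/-- The one-sided function `y ↦ e^{-y / a}` on `(0, ∞)`, for `a > 0`. -/
noncomputable def expIoi (a y : ℝ) : ℝ := (Ioi 0).indicator (fun y => exp (-(y / a))) y

/-- The indicator function of the positive half-line. -/
noncomputable def indIoi (y : ℝ) : ℝ := (Ioi 0).indicator (fun _ => 1) y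

@[fun_prop]
theorem measurable_expIio (a : ℝ) : Measurable (expIio a) :=
  Measurable.indicator (by fun_prop) measurableSet_Iio

@[fun_prop]
theorem measurable_expIoi (a : ℝ) : Measurable (expIoi a) :=
  Measurable.indicator (by fun_prop) measurableSet_Ioi

@[fun_prop]
theorem measurable_indIoi : Measurable indIoi :=
  Measurable.indicator (by fun_prop) measurableSet_Ioi

theorem indIoi_of_pos {y : ℝ} (h : 0 < y) : indIoi y = 1 := indicator_of_mem h _

theorem indIoi_of_nonpos {y : ℝ} (h : y ≤ 0) : indIoi y = 0 := indicator_of_notMem (not_lt.2 h) _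

theorem expIio_of_neg (a : ℝ) {y : ℝ} (h : y < 0) : expIio a y = exp (y / a) :=
  indicator_of_mem (mem_Iio.2 h) _

theorem expIio_of_nonneg (a : ℝ) {y : ℝ} (h : 0 ≤ y) : expIio a y = 0 :=
  indicator_of_notMem (notMem_Iio.2 h) _

theorem expIoi_of_pos (a : ℝ) {y : ℝ} (h : 0 < y) : expIoi a y = exp (-(y / a)) :=
  indicator_of_mem h _

theorem expIoi_of_nonpos (a : ℝ) {y : ℝ} (h : y ≤ 0) : expIoi a y = 0 :=
  indicator_of_notMem (not_lt.2 h) _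

theorem abs_indIoi_le (y : ℝ) : |indIoi y| ≤ 1 := by
  unfold indIoi indicator; split_ifs <;> simp

theorem abs_expIio_le {a : ℝ} (ha : 0 < a) (y : ℝ) : |expIio a y| ≤ 1 := by
  unfold expIio indicator
  split_ifs with h
  · rw [abs_of_pos (exp_pos _), exp_le_one_iff]
    exact div_nonpos_of_nonpos_of_nonneg (le_of_lt h) ha.le
  · simp

theorem abs_expIoi_le {a : ℝ} (ha : 0 < a) (y : ℝ) : |expIoi a y| ≤ 1 := by
  unfold expIoi indicator
  split_ifs with h
  · rw [abs_of_pos (exp_pos _), exp_le_one_iff, neg_nonpos]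
    exact div_nonneg (le_of_lt h) ha.le
  · simp

theorem integrable_of_abs_le {α : Type*} [MeasurableSpace α] {μ : Measure α} [IsFiniteMeasure μ]
    {h : α → ℝ} (hh : Measurable h) {C : ℝ} (hb : ∀ x, |h x| ≤ C) : Integrable h μ :=
  .of_bound hh.aestronglyMeasurable C (Eventually.of_forall hb)

theorem integral_sub_one_mul_indIoi_of_pos {a : ℝ} (ha : 0 < a) (r : ℝ) :
    ∫ t, (t - 1) * indIoi (a * t + r) ∂expMeasure 1
      = ∫ t, expIio a (a * t + r) ∂expMeasure 1 := by
  have i1 : Integrable (fun t => (t - 1) * indIoi (a * t + r)) (expMeasure 1) :=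
    integrable_mul_indicator_of_bounded integrable_sub_one_expMeasure_one (by fun_prop) 1
      fun _ => abs_indIoi_le _
  have i2 : Integrable (fun t => expIio a (a * t + r)) (expMeasure 1) :=
    integrable_of_abs_le (by fun_prop) fun _ => abs_expIio_le ha _
  rw [← sub_eq_zero, ← integral_sub i1 i2]
  refine integral_expMeasure_one_eq_zero_of_hasDerivAt (τ := -r / a)
    (G := fun t => -(t * min (exp (-t)) (exp (r / a)))) (by fun_prop) (by simp) ?_ ?_ (i1.sub i2)
  · rw [← neg_zero]
    refine (tendsto_mul_exp_neg_atTop.congr' ?_).neg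
    filter_upwards [eventually_ge_atTop (-(r / a))] with t ht
    rw [min_eq_left (exp_le_exp.2 (by linarith))]
  · intro t _ htτ
    rcases lt_or_gt_of_ne htτ with h | h
    · have hy : a * t + r < 0 := by rw [lt_div_iff₀ ha] at h; linarith
      have hd : HasDerivAt (fun t => -(t * exp (r / a))) (-(1 * exp (r / a))) t :=
        ((hasDerivAt_id t).mul_const _).neg
      have e : (fun t => -(t * min (exp (-t)) (exp (r / a)))) =ᶠ[𝓝 t]
          fun t => -(t * exp (r / a)) := by
        filter_upwards [Iio_mem_nhds h] with s hs
        rw [min_eq_right (exp_le_exp.2 _)]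
        have : s < -r / a := hs
        rw [neg_div] at this; linarith
      refine (hd.congr_of_eventuallyEq e).congr_deriv ?_
      rw [indIoi_of_nonpos hy.le, expIio_of_neg a hy]
      rw [mul_zero, zero_sub, mul_neg, ← exp_add, one_mul]
      congr 2
      field_simp
      ring
    · have hy : 0 < a * t + r := by rw [div_lt_iff₀ ha] at h; linarith
      have hd : HasDerivAt (fun t => -(t * exp (-t))) (-(1 * exp (-t) + t * (exp (-t) * -1))) t :=
        ((hasDerivAt_id t).mul ((hasDerivAt_neg t).exp)).neg
      have e : (fun t => -(t * min (exp (-t)) (exp (r / a)))) =ᶠ[𝓝 t]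
          fun t => -(t * exp (-t)) := by
        filter_upwards [Ioi_mem_nhds h] with s hs
        rw [min_eq_left (exp_le_exp.2 _)]
        have : -r / a < s := hs
        rw [neg_div] at this; linarith
      refine (hd.congr_of_eventuallyEq e).congr_deriv ?_
      rw [indIoi_of_pos hy, expIio_of_nonneg a hy.le]
      ring

theorem integral_sub_one_mul_indIoi_of_neg {a : ℝ} (ha : 0 < a) (r : ℝ) :
    ∫ t, (t - 1) * indIoi (-a * t + r) ∂expMeasure 1
      = -∫ t, expIoi a (-a * t + r) ∂expMeasure 1 := by
  have i1 : Integrable (fun t => (t - 1) * indIoi (-a * t + r)) (expMeasure 1) :=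
    integrable_mul_indicator_of_bounded integrable_sub_one_expMeasure_one (by fun_prop) 1
      fun _ => abs_indIoi_le _
  have i2 : Integrable (fun t => expIoi a (-a * t + r)) (expMeasure 1) :=
    integrable_of_abs_le (by fun_prop) fun _ => abs_expIoi_le ha _
  rw [← add_eq_zero_iff_eq_neg, ← integral_add i1 i2]
  refine integral_expMeasure_one_eq_zero_of_hasDerivAt (τ := r / a)
    (G := fun t => -(t * max (exp (-t) - exp (-(r / a))) 0)) (by fun_prop) (by simp) ?_ ?_
    (i1.add i2)
  · refine tendsto_const_nhds.congr' ?_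
    filter_upwards [eventually_ge_atTop (r / a)] with t ht
    rw [max_eq_right (sub_nonpos.2 (exp_le_exp.2 (by linarith)))]
    simp
  · intro t _ htτ
    rcases lt_or_gt_of_ne htτ with h | h
    · have hy : 0 < -a * t + r := by rw [lt_div_iff₀ ha] at h; linarith
      have hd : HasDerivAt (fun t => -(t * (exp (-t) - exp (-(r / a)))))
          (-(1 * (exp (-t) - exp (-(r / a))) + t * (exp (-t) * -1))) t :=
        ((hasDerivAt_id t).mul (((hasDerivAt_neg t).exp).sub_const _)).neg
      have e : (fun t => -(t * max (exp (-t) - exp (-(r / a))) 0)) =ᶠ[𝓝 t]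
          fun t => -(t * (exp (-t) - exp (-(r / a)))) := by
        filter_upwards [Iio_mem_nhds h] with s hs
        have : s < r / a := hs
        rw [max_eq_left (sub_nonneg.2 (exp_le_exp.2 (by linarith)))]
      refine (hd.congr_of_eventuallyEq e).congr_deriv ?_
      rw [indIoi_of_pos hy, expIoi_of_pos a hy]
      rw [mul_add, ← exp_add]
      have : -t + -((-a * t + r) / a) = -(r / a) := by field_simp; ring
      rw [this]
      ring
    · have hy : -a * t + r < 0 := by rw [div_lt_iff₀ ha] at h; linarith
      have e : (fun t => -(t * max (exp (-t) - exp (-(r / a))) 0)) =ᶠ[𝓝 t] fun t => 0 := by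
        filter_upwards [Ioi_mem_nhds h] with s hs
        have : r / a < s := hs
        rw [max_eq_right (sub_nonpos.2 (exp_le_exp.2 (by linarith)))]
        simp
      refine ((hasDerivAt_const t (0 : ℝ)).congr_of_eventuallyEq e).congr_deriv ?_
      rw [indIoi_of_nonpos hy.le, expIoi_of_nonpos a hy.le]
      ring

theorem integral_sub_one_mul_posPart (a r : ℝ) :
    ∫ t, (t - 1) * max (a * t + r) 0 ∂expMeasure 1
      = ∫ t, a * (t * indIoi (a * t + r)) ∂expMeasure 1 := by
  have i0 : Integrable (fun t : ℝ => t) (expMeasure 1) := by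
    simpa using integrable_pow_expMeasure_one 1
  have i1 : Integrable (fun t => (t - 1) * max (a * t + r) 0) (expMeasure 1) := by
    have hL : MemLp (fun t : ℝ => t) 2 (expMeasure 1) := by
      exact_mod_cast memLp_expMeasure_one (k := 2) two_ne_zero
    have h2 : MemLp (fun t => a * t + r) 2 (expMeasure 1) :=
      (hL.const_mul a).add (memLp_const r)
    exact (hL.sub (memLp_const 1)).integrable_mul h2.pos_part
  have i2 : Integrable (fun t => a * (t * indIoi (a * t + r))) (expMeasure 1) :=
    (integrable_mul_indicator_of_bounded i0 (by fun_prop) 1 fun _ => abs_indIoi_le _).const_mul a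
  rw [← sub_eq_zero, ← integral_sub i1 i2]
  refine integral_expMeasure_one_eq_zero_of_hasDerivAt (τ := -r / a)
    (G := fun t => -(t * exp (-t) * max (a * t + r) 0)) (by fun_prop) (by simp) ?_ ?_ (i1.sub i2)
  · have h2 : Tendsto (fun t : ℝ => t ^ 2 * exp (-t)) atTop (𝓝 0) :=
      tendsto_pow_mul_exp_neg_atTop_nhds_zero 2
    have h3 : Tendsto (fun t : ℝ => |a| * (t ^ 2 * exp (-t)) + |r| * (t * exp (-t))) atTop
        (𝓝 0) := by
      simpa using (h2.const_mul |a|).add (tendsto_mul_exp_neg_atTop.const_mul |r|)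
    refine squeeze_zero_norm' ?_ h3
    filter_upwards [eventually_ge_atTop 0] with t ht
    have hm : max (a * t + r) 0 ≤ |a| * t + |r| :=
      max_le (add_le_add (mul_le_mul_of_nonneg_right (le_abs_self a) ht) (le_abs_self r))
        (by positivity)
    have hp : 0 ≤ t * exp (-t) := by positivity
    rw [norm_neg, norm_of_nonneg (mul_nonneg hp (le_max_right _ _))]
    nlinarith [mul_le_mul_of_nonneg_left hm hp]
  · intro t _ htτ
    by_cases hy : 0 < a * t + r
    · have hl : HasDerivAt (fun t => a * t + r) (a * 1) t :=
        ((hasDerivAt_id t).const_mul a).add_const r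
      have hd : HasDerivAt (fun t => -(t * exp (-t) * (a * t + r)))
          (-((1 * exp (-t) + t * (exp (-t) * -1)) * (a * t + r) + t * exp (-t) * (a * 1))) t :=
        (((hasDerivAt_id t).mul ((hasDerivAt_neg t).exp)).mul hl).neg
      have e : (fun t => -(t * exp (-t) * max (a * t + r) 0)) =ᶠ[𝓝 t]
          fun t => -(t * exp (-t) * (a * t + r)) := by
        have : ∀ᶠ s in 𝓝 t, 0 < a * s + r :=
          (continuous_const.mul continuous_id |>.add continuous_const).continuousAt.eventually
            (lt_mem_nhds hy)
        filter_upwards [this] with s hs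
        rw [max_eq_left hs.le]
      refine (hd.congr_of_eventuallyEq e).congr_deriv ?_
      rw [indIoi_of_pos hy, max_eq_left hy.le]
      ring
    · have e : (fun t => -(t * exp (-t) * max (a * t + r) 0)) =ᶠ[𝓝 t] fun t => 0 := by
        rcases eq_or_ne a 0 with rfl | ha
        · refine Eventually.of_forall fun s => ?_
          have : 0 * s + r ≤ 0 := by linarith
          simp only [max_eq_right this]
          simp
        · have hy' : a * t + r < 0 := by
            refine lt_of_le_of_ne (not_lt.1 hy) fun h => htτ ?_
            field_simp
            linarith
          have : ∀ᶠ s in 𝓝 t, a * s + r < 0 :=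
            (continuous_const.mul continuous_id |>.add continuous_const).continuousAt.eventually
              (gt_mem_nhds hy')
          filter_upwards [this] with s hs
          rw [max_eq_right hs.le]
          simp
      refine ((hasDerivAt_const t (0 : ℝ)).congr_of_eventuallyEq e).congr_deriv ?_
      rw [indIoi_of_nonpos (not_lt.1 hy), max_eq_right (not_lt.1 hy)]
      ring

/-! ### Products of standard exponential measures -/

/-- The law of `k` i.i.d. standard exponential random variables. -/
noncomputable abbrev expPi (k : ℕ) : Measure (Fin k → ℝ) := Measure.pi fun _ => expMeasure 1

theorem integral_expPi_succAbove {n : ℕ} (j : Fin (n + 1)) (a : Fin (n + 1) → ℝ)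
    (g : ℝ → ℝ → ℝ) :
    ∫ x, g (x j) (∑ i, a i * x i) ∂expPi (n + 1)
      = ∫ q, g q.1 (a j * q.1 + ∑ i, a (j.succAbove i) * q.2 i)
          ∂(expMeasure 1).prod (expPi n) := by
  have h := measurePreserving_piFinSuccAbove (fun _ : Fin (n + 1) => expMeasure 1) j
  rw [← h.integral_comp' (fun q : ℝ × (Fin n → ℝ) =>
    g q.1 (a j * q.1 + ∑ i, a (j.succAbove i) * q.2 i))]
  refine integral_congr_ae (Eventually.of_forall fun x => ?_)
  simp [Fin.sum_univ_succAbove _ j, MeasurableEquiv.piFinSuccAbove, Fin.insertNthEquiv,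
    Fin.removeNth]

theorem integrable_expPi_succAbove {n : ℕ} (j : Fin (n + 1)) (a : Fin (n + 1) → ℝ)
    {g : ℝ → ℝ → ℝ} (hg : Integrable (fun x => g (x j) (∑ i, a i * x i)) (expPi (n + 1))) :
    Integrable (fun q : ℝ × (Fin n → ℝ) => g q.1 (a j * q.1 + ∑ i, a (j.succAbove i) * q.2 i))
      ((expMeasure 1).prod (expPi n)) := by
  have h := measurePreserving_piFinSuccAbove (fun _ : Fin (n + 1) => expMeasure 1) j
  rw [← h.integrable_comp_emb (MeasurableEquiv.measurableEmbedding _)]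
  refine hg.congr (Eventually.of_forall fun x => ?_)
  simp [Fin.sum_univ_succAbove _ j, MeasurableEquiv.piFinSuccAbove, Fin.insertNthEquiv,
    Fin.removeNth]

/-- Two functionals of a coordinate and a linear combination of the coordinates have the same
expectation if they agree after averaging over that single coordinate. -/
theorem integral_expPi_congr_coord {n : ℕ} (j : Fin (n + 1)) (a : Fin (n + 1) → ℝ)
    {g₁ g₂ : ℝ → ℝ → ℝ}
    (h₁ : Integrable (fun x => g₁ (x j) (∑ i, a i * x i)) (expPi (n + 1)))
    (h₂ : Integrable (fun x => g₂ (x j) (∑ i, a i * x i)) (expPi (n + 1)))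
    (h : ∀ r, ∫ t, g₁ t (a j * t + r) ∂expMeasure 1 = ∫ t, g₂ t (a j * t + r) ∂expMeasure 1) :
    ∫ x, g₁ (x j) (∑ i, a i * x i) ∂expPi (n + 1)
      = ∫ x, g₂ (x j) (∑ i, a i * x i) ∂expPi (n + 1) := by
  rw [integral_expPi_succAbove, integral_expPi_succAbove,
    integral_prod_symm _ (integrable_expPi_succAbove j a h₁),
    integral_prod_symm _ (integrable_expPi_succAbove j a h₂)]
  simp only [h]

theorem memLp_eval_expPi {k : ℕ} (j : Fin k) {q : ℕ} (hq : q ≠ 0) :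
    MemLp (fun x : Fin k → ℝ => x j) q (expPi k) :=
  (memLp_expMeasure_one hq).comp_measurePreserving
    (measurePreserving_eval (fun _ : Fin k => expMeasure 1) j)

theorem memLp_sum_expPi {k : ℕ} (a : Fin k → ℝ) {q : ℕ} (hq : q ≠ 0) :
    MemLp (fun x : Fin k → ℝ => ∑ j, a j * x j) q (expPi k) :=
  memLp_finsetSum _ fun j _ => (memLp_eval_expPi j hq).const_mul (a j)

theorem MemLp.integrable_pow_of_ne_zero {α : Type*} [MeasurableSpace α] {μ : Measure α}
    {f : α → ℝ} {q : ℕ} (hq : q ≠ 0) (hf : MemLp f q μ) : Integrable (fun x => f x ^ q) μ := by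
  have h := hf.integrable_norm_pow hq
  refine h.mono' (hf.1.pow q) (Eventually.of_forall fun x => ?_)
  simp

theorem integrable_centered_pow (k : ℕ) :
    Integrable (fun t : ℝ => (t - 1) ^ k) (expMeasure 1) := by
  rcases eq_or_ne k 0 with rfl | hk
  · simp
  have h : MemLp (fun t : ℝ => t - 1) k (expMeasure 1) :=
    (memLp_expMeasure_one hk).sub (memLp_const 1)
  exact MemLp.integrable_pow_of_ne_zero hk h

/-- `f` is integrable with integral `v`. -/
def HasIntegralValue {α : Type*} [MeasurableSpace α] (μ : Measure α) (f : α → ℝ) (v : ℝ) : Prop :=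
  Integrable f μ ∧ ∫ x, f x ∂μ = v

namespace HasIntegralValue

variable {α : Type*} [MeasurableSpace α] {μ : Measure α} {f g : α → ℝ} {v w : ℝ}

theorem add (hf : HasIntegralValue μ f v) (hg : HasIntegralValue μ g w) :
    HasIntegralValue μ (fun x => f x + g x) (v + w) :=
  ⟨hf.1.add hg.1, by rw [integral_add hf.1 hg.1, hf.2, hg.2]⟩

theorem sub (hf : HasIntegralValue μ f v) (hg : HasIntegralValue μ g w) :
    HasIntegralValue μ (fun x => f x - g x) (v - w) :=
  ⟨hf.1.sub hg.1, by rw [integral_sub hf.1 hg.1, hf.2, hg.2]⟩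

theorem const_mul (c : ℝ) (hf : HasIntegralValue μ f v) :
    HasIntegralValue μ (fun x => c * f x) (c * v) :=
  ⟨hf.1.const_mul c, by rw [integral_const_mul, hf.2]⟩

theorem congr (hf : HasIntegralValue μ f v) (h : ∀ x, g x = f x) (h' : w = v) :
    HasIntegralValue μ g w := by
  obtain rfl : g = f := funext h
  exact h' ▸ hf

end HasIntegralValue

theorem integral_centered_one : ∫ t : ℝ, (t - 1) ∂expMeasure 1 = 0 := by
  have i := integrable_pow_expMeasure_one
  have e := integral_pow_expMeasure_one
  have i1 := i 1; have e1 := e 1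
  simp only [pow_one] at i1 e1
  rw [integral_sub i1 (integrable_const _), e1]
  simp

theorem hasIntegralValue_pow_expMeasure_one (k : ℕ) :
    HasIntegralValue (expMeasure 1) (fun t : ℝ => t ^ k) k ! :=
  ⟨integrable_pow_expMeasure_one k, integral_pow_expMeasure_one k⟩

theorem integral_centered_sq : ∫ t : ℝ, (t - 1) ^ 2 ∂expMeasure 1 = 1 := by
  have e := hasIntegralValue_pow_expMeasure_one
  exact ((((e 2).sub ((e 1).const_mul 2)).add ((e 0).const_mul 1)).congr
    (fun t => by ring) (by norm_num [Nat.factorial])).2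

theorem integral_centered_fourth : ∫ t : ℝ, (t - 1) ^ 4 ∂expMeasure 1 = 9 := by
  have e := hasIntegralValue_pow_expMeasure_one
  exact ((((((e 4).sub ((e 3).const_mul 4)).add ((e 2).const_mul 6)).sub
    ((e 1).const_mul 4)).add ((e 0).const_mul 1)).congr
    (fun t => by ring) (by norm_num [Nat.factorial])).2

/-- The first four moments of a centered linear combination of independent exponentials. -/
theorem moments_centered_sum : ∀ {k : ℕ} (b : Fin k → ℝ),
    (∀ q : ℕ, Integrable (fun x => (∑ j, b j * (x j - 1)) ^ q) (expPi k)) ∧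
    ∫ x, ∑ j, b j * (x j - 1) ∂expPi k = 0 ∧
    ∫ x, (∑ j, b j * (x j - 1)) ^ 2 ∂expPi k = ∑ j, b j ^ 2 ∧
    ∫ x, (∑ j, b j * (x j - 1)) ^ 4 ∂expPi k ≤ 9 * (∑ j, b j ^ 2) ^ 2 := by
  intro k
  induction k with
  | zero => intro b; simp
  | succ k ih =>
    intro b
    obtain ⟨hi, h1, h2, h4⟩ := ih (fun i => b i.succ)
    have hint : ∀ q : ℕ, Integrable (fun x => (∑ j, b j * (x j - 1)) ^ q) (expPi (k + 1)) := by
      intro q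
      rcases eq_or_ne q 0 with rfl | hq
      · simp
      have h : MemLp (fun x : Fin (k + 1) → ℝ => ∑ j, b j * (x j - 1)) q (expPi (k + 1)) :=
        memLp_finsetSum _ fun j _ =>
          ((memLp_eval_expPi j hq).sub (memLp_const 1)).const_mul (b j)
      exact MemLp.integrable_pow_of_ne_zero hq h
    set Z : (Fin k → ℝ) → ℝ := fun z => ∑ i, b i.succ * (z i - 1) with hZ
    have key : ∀ ψ : ℝ → ℝ, ∫ x, ψ (∑ j, b j * (x j - 1)) ∂expPi (k + 1)
        = ∫ q, ψ (b 0 * (q.1 - 1) + Z q.2) ∂(expMeasure 1).prod (expPi k) := by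
      intro ψ
      have h := measurePreserving_piFinSuccAbove (fun _ : Fin (k + 1) => expMeasure 1) 0
      rw [← h.integral_comp' (fun q : ℝ × (Fin k → ℝ) => ψ (b 0 * (q.1 - 1) + Z q.2))]
      refine integral_congr_ae (Eventually.of_forall fun x => ?_)
      simp [Fin.sum_univ_succ, MeasurableEquiv.piFinSuccAbove, Fin.insertNthEquiv,
        Fin.tail, hZ]
    have hval : ∀ p q : ℕ, HasIntegralValue ((expMeasure 1).prod (expPi k))
        (fun w : ℝ × (Fin k → ℝ) => (w.1 - 1) ^ p * Z w.2 ^ q)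
        ((∫ t, (t - 1) ^ p ∂expMeasure 1) * ∫ z, Z z ^ q ∂expPi k) := fun p q =>
      ⟨(integrable_centered_pow p).mul_prod (hi q),
        integral_prod_mul (fun t : ℝ => (t - 1) ^ p) (fun z => Z z ^ q)⟩
    have c1 : ∫ t : ℝ, (t - 1) ^ 1 ∂expMeasure 1 = 0 := by simp [integral_centered_one]
    have h1' : ∫ z, Z z ^ 1 ∂expPi k = 0 := by simpa using h1
    refine ⟨hint, ?_, ?_, ?_⟩
    · rw [key fun y => y]
      exact ((((hval 1 0).const_mul (b 0)).add (hval 0 1)).congr (fun w => by ring)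
        (by rw [c1, h1']; ring)).2
    · rw [key fun y => y ^ 2]
      refine (((((hval 2 0).const_mul (b 0 ^ 2)).add ((hval 1 1).const_mul (2 * b 0))).add
        (hval 0 2)).congr (fun w => by ring) ?_).2
      rw [c1, h1', h2, integral_centered_sq, Fin.sum_univ_succ]
      simp
    · rw [key fun y => y ^ 4]
      rw [((((((hval 4 0).const_mul (b 0 ^ 4)).add ((hval 3 1).const_mul (4 * b 0 ^ 3))).add
        ((hval 2 2).const_mul (6 * b 0 ^ 2))).add ((hval 1 3).const_mul (4 * b 0))).add
        (hval 0 4)).congr (g := fun w => (b 0 * (w.1 - 1) + Z w.2) ^ 4) (fun w => by ring) rfl |>.2]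
      rw [c1, h1', h2, integral_centered_sq, integral_centered_fourth, Fin.sum_univ_succ]
      have hS : 0 ≤ ∑ i : Fin k, b i.succ ^ 2 := Finset.sum_nonneg fun i _ => sq_nonneg _
      simp only [pow_zero, integral_const, probReal_univ, smul_eq_mul]
      nlinarith [h4, mul_nonneg (sq_nonneg (b 0)) hS]

/-! ### Log-concavity and convolution with exponentials -/

/-- The two-point form of log-concavity: `f x * f (y + s) ≤ f (x + s) * f y` for `x ≤ y` and
`0 ≤ s`. -/
def IsPF2 (f : ℝ → ℝ) : Prop :=
  ∀ x y s, x ≤ y → 0 ≤ s → f x * f (y + s) ≤ f (x + s) * f y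

theorem IsPF2.comp_neg {f : ℝ → ℝ} (hf : IsPF2 f) : IsPF2 fun x => f (-x) := by
  intro x y s hxy hs
  have h := hf (-y - s) (-x - s) s (by linarith) hs
  simp only [sub_add_cancel] at h
  simp only [neg_add']
  linarith

/-- A nonnegative bounded continuous log-concave function. -/
structure IsGoodPF2 (f : ℝ → ℝ) (C : ℝ) : Prop where
  cont : Continuous f
  nonneg : ∀ x, 0 ≤ f x
  le : ∀ x, f x ≤ C
  pf2 : IsPF2 f

namespace IsGoodPF2

variable {f : ℝ → ℝ} {C : ℝ}

theorem comp_neg (hf : IsGoodPF2 f C) : IsGoodPF2 (fun x => f (-x)) C :=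
  ⟨hf.cont.comp continuous_neg, fun _ => hf.nonneg _, fun _ => hf.le _, hf.pf2.comp_neg⟩

theorem abs_le (hf : IsGoodPF2 f C) (x : ℝ) : |f x| ≤ C := by
  rw [abs_of_nonneg (hf.nonneg x)]; exact hf.le x

theorem integrable_comp (hf : IsGoodPF2 f C) {α : Type*} [MeasurableSpace α] {μ : Measure α}
    [IsFiniteMeasure μ] {h : α → ℝ} (hh : Measurable h) : Integrable (fun t => f (h t)) μ :=
  integrable_of_abs_le (hf.cont.measurable.comp hh) fun _ => hf.abs_le _

theorem expConv_pf2_of_pos (hf : IsGoodPF2 f C) {b : ℝ} (hb : 0 < b) :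
    IsPF2 fun x => ∫ t, f (x - b * t) ∂expMeasure 1 := by
  intro x y s hxy hs
  simp only
  set F : ℝ → ℝ := fun x => ∫ t, f (x - b * t) ∂expMeasure 1 with hF
  set σ := s / b with hσ
  have hbσ : b * σ = s := by rw [hσ]; field_simp
  have hσ0 : 0 ≤ σ := by positivity
  have hI : ∀ x, Integrable (fun t => f (x - b * t)) (expMeasure 1) := fun x =>
    hf.integrable_comp (by fun_prop)
  have split : ∀ x, F (x + s) = (∫ t in Ioc 0 σ, exp (-t) * f (x + s - b * t))
      + exp (-σ) * F x := by
    intro x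
    have hi := integrable_expMeasure_one_iff.1 (hI (x + s))
    have e : F (x + s) = (∫ t in Ioc 0 σ, exp (-t) * f (x + s - b * t))
        + ∫ t in Ioi σ, exp (-t) * f (x + s - b * t) := by
      rw [hF]
      simp only
      rw [integral_expMeasure_one, ← Ioc_union_Ioi_eq_Ioi hσ0,
        setIntegral_union (Ioc_disjoint_Ioi le_rfl) measurableSet_Ioi
          (hi.mono_set Ioc_subset_Ioi_self) (hi.mono_set (Ioi_subset_Ioi hσ0))]
    rw [e, hF]
    simp only
    rw [integral_expMeasure_one, ← integral_const_mul]
    congr 1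
    have h := (measurePreserving_add_right volume σ).setIntegral_preimage_emb
      (measurableEmbedding_addRight σ) (fun t => exp (-t) * f (x + s - b * t)) (Ioi σ)
    rw [preimage_add_const_Ioi, sub_self] at h
    rw [← h]
    refine setIntegral_congr_fun measurableSet_Ioi fun t _ => ?_
    rw [neg_add, exp_add, ← hbσ]
    ring_nf
  have key : ∀ s', 0 ≤ s' → F x * f (y + s') ≤ F y * f (x + s') := by
    intro s' hs'
    rw [hF]
    simp only
    rw [← integral_mul_const, ← integral_mul_const]
    refine integral_mono_ae ((hI x).mul_const _) ((hI y).mul_const _) ?_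
    filter_upwards [ae_expMeasure_one_pos] with τ hτ
    have h := hf.pf2 (x - b * τ) (y - b * τ) (s' + b * τ) (by linarith) (by positivity)
    rw [show y - b * τ + (s' + b * τ) = y + s' by ring,
      show x - b * τ + (s' + b * τ) = x + s' by ring] at h
    linarith
  change F x * F (y + s) ≤ F (x + s) * F y
  rw [split x, split y]
  have main : F x * (∫ t in Ioc 0 σ, exp (-t) * f (y + s - b * t))
      ≤ F y * ∫ t in Ioc 0 σ, exp (-t) * f (x + s - b * t) := by
    rw [← integral_const_mul, ← integral_const_mul]
    have hi : ∀ x, IntegrableOn (fun t => exp (-t) * f (x - b * t)) (Ioc 0 σ) := fun x =>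
      (integrable_expMeasure_one_iff.1 (hI x)).mono_set Ioc_subset_Ioi_self
    refine setIntegral_mono_on ((hi _).const_mul _) ((hi _).const_mul _) measurableSet_Ioc ?_
    intro t ht
    have h := key (s - b * t) (by nlinarith [ht.2])
    rw [← add_sub_assoc, ← add_sub_assoc] at h
    have := mul_le_mul_of_nonneg_left h (exp_pos (-t)).le
    linarith
  linarith

theorem expConv (hf : IsGoodPF2 f C) (b : ℝ) :
    IsGoodPF2 (fun x => ∫ t, f (x - b * t) ∂expMeasure 1) C where
  cont := by
    refine continuous_of_dominated (bound := fun _ => C) (fun x => ?_) (fun x => ?_)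
      (integrable_const C) ?_
    · exact (hf.cont.comp (by fun_prop)).aestronglyMeasurable
    · exact Eventually.of_forall fun t => hf.abs_le _
    · exact Eventually.of_forall fun t => hf.cont.comp (by fun_prop)
  nonneg x := integral_nonneg fun t => hf.nonneg _
  le x := by
    have := integral_mono (μ := expMeasure 1) (hf.integrable_comp (h := fun t => x - b * t)
      (by fun_prop)) (integrable_const C) fun t => hf.le _
    simpa using this
  pf2 := by
    rcases lt_trichotomy b 0 with hb | rfl | hb
    · have := (hf.comp_neg.expConv_pf2_of_pos (neg_pos.2 hb)).comp_neg
      convert this using 6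
      ring
    · simpa using hf.pf2
    · exact hf.expConv_pf2_of_pos hb

end IsGoodPF2

/-- The density `f` shifted by an independent linear combination of exponentials. -/
noncomputable def mixConv {k : ℕ} (b : Fin k → ℝ) (f : ℝ → ℝ) (x : ℝ) : ℝ :=
  ∫ z, f (x - ∑ i, b i * z i) ∂expPi k

theorem IsGoodPF2.mixConv {f : ℝ → ℝ} {C : ℝ} (hf : IsGoodPF2 f C) :
    ∀ {k : ℕ} (b : Fin k → ℝ), IsGoodPF2 (mixConv b f) C := by
  intro k
  induction k with
  | zero =>
    intro b
    have : _root_.mixConv b f = f := by funext x; simp [_root_.mixConv]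
    rwa [this]
  | succ k ih =>
    intro b
    have h := (ih fun i => b i.succ).expConv (b 0)
    have : _root_.mixConv b f
        = fun x => ∫ t, _root_.mixConv (fun i => b i.succ) f (x - b 0 * t) ∂expMeasure 1 := by
      funext x
      unfold _root_.mixConv
      rw [integral_expPi_succAbove 0 b fun _ y => f (x - y), integral_prod]
      · simp [sub_sub]
      · exact hf.integrable_comp (by fun_prop)
    rwa [this]

/-! ### The density of a linear combination of exponentials -/

theorem lintegral_mul_sub_expMeasure_one {u : ℝ} (hu : 0 < u) (c : ℝ) {h : ℝ → ℝ≥0∞}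
    (hh : Measurable h) : ∫⁻ s, h (u * s - c) ∂expMeasure 1
      = ∫⁻ y, ENNReal.ofReal (u⁻¹ * (indIoi ((y + c) / u) * exp (-((y + c) / u)))) * h y := by
  set G : ℝ → ℝ≥0∞ := fun y => ENNReal.ofReal (indIoi (y / u) * exp (-(y / u))) * h (y - c)
    with hG
  have hGm : Measurable G := by fun_prop
  have h1 : ∫⁻ s, h (u * s - c) ∂expMeasure 1 = ∫⁻ s, G (u * s) := by
    rw [lintegral_expMeasure_one (by fun_prop), ← lintegral_indicator measurableSet_Ioi]
    refine lintegral_congr fun s => ?_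
    by_cases hs : 0 < s
    · simp [hG, hs, hu.ne', indIoi_of_pos]
    · simp [hG, hs, hu.ne', indIoi_of_nonpos (not_lt.1 hs)]
  have h2 : ∫⁻ s, G (u * s) = ENNReal.ofReal u⁻¹ * ∫⁻ y, G y := by
    rw [← lintegral_map hGm (by fun_prop), Real.map_volume_mul_left hu.ne',
      lintegral_smul_measure, abs_of_pos (inv_pos.2 hu), smul_eq_mul]
  rw [h1, h2, ← lintegral_add_right_eq_self G c, ← lintegral_const_mul _ (by fun_prop)]
  refine lintegral_congr fun y => ?_
  rw [ENNReal.ofReal_mul (inv_pos.2 hu).le, hG]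
  simp [mul_assoc]

/-- The density of `u s - v t` for independent standard exponential `s`, `t`. -/
noncomputable def laplaceDensity (u v y : ℝ) : ℝ := (u + v)⁻¹ * exp (min (-(y / u)) (y / v))

theorem integral_indIoi_mul_exp {u v : ℝ} (hu : 0 < u) (hv : 0 < v) (y : ℝ) :
    ∫ t, u⁻¹ * (indIoi ((y + v * t) / u) * exp (-((y + v * t) / u))) ∂expMeasure 1
      = laplaceDensity u v y := by
  rw [integral_expMeasure_one]
  have e : ∀ t, exp (-t) * (u⁻¹ * (indIoi ((y + v * t) / u) * exp (-((y + v * t) / u))))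
      = (Ioi (-(y / v))).indicator
        (fun t => u⁻¹ * exp (-(y / u)) * exp (-((u + v) / u) * t)) t := by
    intro t
    by_cases ht : -(y / v) < t
    · have : 0 < y + v * t := by
        rw [← neg_div, div_lt_iff₀ hv] at ht; linarith
      rw [indIoi_of_pos (div_pos this hu), indicator_of_mem (mem_Ioi.2 ht)]
      have : exp (-(y / u)) * exp (-((u + v) / u) * t) = exp (-t) * exp (-((y + v * t) / u)) := by
        rw [← exp_add, ← exp_add]; congr 1; field_simp; ring
      linear_combination (-u⁻¹) * this
    · have : y + v * t ≤ 0 := by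
        rw [not_lt, ← neg_div, le_div_iff₀ hv] at ht; linarith
      rw [indIoi_of_nonpos (div_nonpos_of_nonpos_of_nonneg this hu.le),
        indicator_of_notMem (by simpa using ht)]
      simp
  simp only [e]
  rw [setIntegral_indicator measurableSet_Ioi, Ioi_inter_Ioi, integral_const_mul,
    integral_exp_mul_Ioi (neg_neg_of_pos (by positivity))]
  have hmin : min (-(y / u)) (y / v) = -(y / u) + -((u + v) / u) * (0 ⊔ -(y / v)) := by
    have hk : -(y / u) + -((u + v) / u) * -(y / v) = y / v := by field_simp; ring
    rcases le_total 0 (-(y / v)) with h | h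
    · rw [sup_eq_right.2 h, hk, min_eq_right]
      rw [← hk]
      have : 0 ≤ (u + v) / u * -(y / v) := by positivity
      linarith
    · rw [sup_eq_left.2 h, mul_zero, add_zero, min_eq_left]
      rw [← hk]
      have : 0 ≤ (u + v) / u * (y / v) := mul_nonneg (by positivity) (by linarith)
      linarith
  rw [laplaceDensity, hmin, exp_add]
  field_simp

theorem continuous_laplaceDensity (u v : ℝ) : Continuous (laplaceDensity u v) := by
  unfold laplaceDensity; fun_prop

theorem isGoodPF2_laplaceDensity {u v : ℝ} (hu : 0 < u) (hv : 0 < v) :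
    IsGoodPF2 (laplaceDensity u v) (u + v)⁻¹ where
  cont := continuous_laplaceDensity u v
  nonneg x := by unfold laplaceDensity; positivity
  le x := by
    unfold laplaceDensity
    refine mul_le_of_le_one_right (by positivity) (exp_le_one_iff.2 ?_)
    rcases le_total 0 x with h | h
    · exact (min_le_left _ _).trans (neg_nonpos.2 (by positivity))
    · exact (min_le_right _ _).trans (div_nonpos_of_nonpos_of_nonneg h hv.le)
  pf2 x y s hxy hs := by
    unfold laplaceDensity
    rw [mul_mul_mul_comm, mul_mul_mul_comm (u + v)⁻¹ (exp (min (-((x + s) / u)) _)), ← exp_add,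
      ← exp_add]
    refine mul_le_mul_of_nonneg_left (exp_le_exp.2 ?_) (by positivity)
    have hs' : 0 ≤ s / u := by positivity
    have hs'' : 0 ≤ s / v := by positivity
    have hx : x / u ≤ y / u := by gcongr
    have hx' : x / v ≤ y / v := by gcongr
    rw [add_div, add_div, add_div, add_div]
    rcases min_choice (-(x / u + s / u)) (x / v + s / v) with h1 | h1 <;>
    rcases min_choice (-(y / u)) (y / v) with h2 | h2 <;> rw [h1, h2] <;>
    linarith [min_le_left (-(x / u)) (x / v), min_le_right (-(x / u)) (x / v),
      min_le_left (-(y / u + s / u)) (y / v + s / v),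
      min_le_right (-(y / u + s / u)) (y / v + s / v)]

theorem lintegral_lintegral_mul_sub_mul {u v : ℝ} (hu : 0 < u) (hv : 0 < v) {h : ℝ → ℝ≥0∞}
    (hh : Measurable h) : ∫⁻ t, ∫⁻ s, h (u * s - v * t) ∂expMeasure 1 ∂expMeasure 1
      = ∫⁻ y, ENNReal.ofReal (laplaceDensity u v y) * h y := by
  simp only [lintegral_mul_sub_expMeasure_one hu _ hh]
  rw [lintegral_lintegral_swap (by fun_prop)]
  refine lintegral_congr fun y => ?_
  rw [lintegral_mul_const _ (by fun_prop), ← integral_indIoi_mul_exp hu hv,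
    ofReal_integral_eq_lintegral_ofReal]
  · refine ((integrable_of_abs_le (h := fun t => indIoi ((y + v * t) / u)
      * exp (-((y + v * t) / u))) (by fun_prop) (C := 1) fun t => ?_).const_mul _)
    unfold indIoi indicator
    split_ifs with ht
    · rw [one_mul, abs_of_pos (exp_pos _), exp_le_one_iff]
      exact neg_nonpos.2 (le_of_lt ht)
    · simp
  · refine Eventually.of_forall fun t => ?_
    refine mul_nonneg (inv_pos.2 hu).le (mul_nonneg ?_ (exp_pos _).le)
    unfold indIoi indicator
    split_ifs <;> simp

theorem lintegral_expPi_succAbove {n : ℕ} (j : Fin (n + 1)) (a : Fin (n + 1) → ℝ)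
    {g : ℝ → ℝ≥0∞} (hg : Measurable g) :
    ∫⁻ x, g (∑ i, a i * x i) ∂expPi (n + 1)
      = ∫⁻ t, ∫⁻ z, g (a j * t + ∑ i, a (j.succAbove i) * z i) ∂expPi n ∂expMeasure 1 := by
  have h := measurePreserving_piFinSuccAbove (fun _ : Fin (n + 1) => expMeasure 1) j
  rw [← lintegral_prod (f := fun q : ℝ × (Fin n → ℝ) =>
    g (a j * q.1 + ∑ i, a (j.succAbove i) * q.2 i)) (by fun_prop), ← h.lintegral_comp_emb
    (MeasurableEquiv.measurableEmbedding _)]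
  refine lintegral_congr fun x => ?_
  simp [Fin.sum_univ_succAbove _ j, MeasurableEquiv.piFinSuccAbove, Fin.insertNthEquiv,
    Fin.removeNth]

theorem lintegral_expPi_eq_lintegral_mixConv {m : ℕ} (a : Fin (m + 2) → ℝ) (hu : 0 < a 0)
    (hv : a (Fin.last (m + 1)) < 0) {g : ℝ → ℝ≥0∞} (hg : Measurable g) :
    ∫⁻ x, g (∑ i, a i * x i) ∂expPi (m + 2)
      = ∫⁻ y, ENNReal.ofReal (mixConv (fun i : Fin m => a i.castSucc.succ)
          (laplaceDensity (a 0) (-a (Fin.last (m + 1)))) y) * g y := by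
  set u := a 0 with hu'
  set v := -a (Fin.last (m + 1)) with hv'
  set b : Fin m → ℝ := fun i => a i.castSucc.succ with hb
  have hv0 : 0 < v := by linarith
  have hL := isGoodPF2_laplaceDensity hu hv0
  have step : ∫⁻ x, g (∑ i, a i * x i) ∂expPi (m + 2)
      = ∫⁻ s, ∫⁻ t, ∫⁻ z, g (u * s - v * t + ∑ i, b i * z i)
          ∂expPi m ∂expMeasure 1 ∂expMeasure 1 := by
    rw [lintegral_expPi_succAbove 0 a hg]
    refine lintegral_congr fun s => ?_
    rw [lintegral_expPi_succAbove (Fin.last m) (fun i => a (Fin.succAbove 0 i))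
      (g := fun y => g (a 0 * s + y)) (by fun_prop)]
    simp [hv', hb, hu', add_assoc]
  calc _ = _ := step
    _ = ∫⁻ t, ∫⁻ s, ∫⁻ z, g (u * s - v * t + ∑ i, b i * z i)
          ∂expPi m ∂expMeasure 1 ∂expMeasure 1 :=
        lintegral_lintegral_swap (Measurable.aemeasurable (Measurable.lintegral_prod_right'
          (f := fun p : (ℝ × ℝ) × (Fin m → ℝ) => g (u * p.1.1 - v * p.1.2 + ∑ i, b i * p.2 i))
          (by fun_prop)))
    _ = ∫⁻ t, ∫⁻ z, ∫⁻ s, g (u * s - v * t + ∑ i, b i * z i)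
          ∂expMeasure 1 ∂expPi m ∂expMeasure 1 := by
        refine lintegral_congr fun t => lintegral_lintegral_swap (by fun_prop)
    _ = ∫⁻ z, ∫⁻ t, ∫⁻ s, g (u * s - v * t + ∑ i, b i * z i)
          ∂expMeasure 1 ∂expMeasure 1 ∂expPi m :=
        lintegral_lintegral_swap (Measurable.aemeasurable (Measurable.lintegral_prod_right'
          (f := fun p : (ℝ × (Fin m → ℝ)) × ℝ => g (u * p.2 - v * p.1.1 + ∑ i, b i * p.1.2 i))
          (by fun_prop)))
    _ = ∫⁻ z, (∫⁻ y, ENNReal.ofReal (laplaceDensity u v (y - ∑ i, b i * z i)) * g y)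
          ∂expPi m := by
        refine lintegral_congr fun z => ?_
        rw [lintegral_lintegral_mul_sub_mul hu hv0 (h := fun y => g (y + ∑ i, b i * z i))
          (by fun_prop), ← lintegral_add_right_eq_self
            (fun y => ENNReal.ofReal (laplaceDensity u v (y - ∑ i, b i * z i)) * g y)
            (∑ i, b i * z i)]
        simp only [add_sub_cancel_right]
    _ = ∫⁻ y, ∫⁻ z, ENNReal.ofReal (laplaceDensity u v (y - ∑ i, b i * z i)) * g y ∂expPi m := by
        refine lintegral_lintegral_swap (Measurable.aemeasurable ?_)
        have := hL.cont.measurable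
        fun_prop
    _ = _ := by
        refine lintegral_congr fun y => ?_
        have := hL.cont.measurable
        rw [lintegral_mul_const _ (by fun_prop), mixConv, ofReal_integral_eq_lintegral_ofReal
          (hL.integrable_comp (by fun_prop)) (Eventually.of_forall fun z => hL.nonneg _)]

/-- The linear combination `∑ aᵢ xᵢ` of i.i.d. exponentials has the log-concave density `f`. -/
structure HasSumDensity {n : ℕ} (a : Fin n → ℝ) (f : ℝ → ℝ) (C : ℝ) : Prop where
  good : IsGoodPF2 f C
  lintegral_eq : ∀ {g : ℝ → ℝ≥0∞}, Measurable g → ∫⁻ x, g (∑ i, a i * x i) ∂expPi n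
    = ∫⁻ y, ENNReal.ofReal (f y) * g y

theorem hasSumDensity_mixConv {m : ℕ} (a : Fin (m + 2) → ℝ) (hu : 0 < a 0)
    (hv : a (Fin.last (m + 1)) < 0) :
    HasSumDensity a (mixConv (fun i : Fin m => a i.castSucc.succ)
      (laplaceDensity (a 0) (-a (Fin.last (m + 1))))) (a 0 + -a (Fin.last (m + 1)))⁻¹ :=
  ⟨(isGoodPF2_laplaceDensity hu (neg_pos.2 hv)).mixConv _,
    fun hg => lintegral_expPi_eq_lintegral_mixConv a hu hv hg⟩

namespace HasSumDensity

variable {n : ℕ} {a : Fin n → ℝ} {f : ℝ → ℝ} {C : ℝ}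

theorem neg (h : HasSumDensity a f C) : HasSumDensity (fun i => -a i) (fun x => f (-x)) C where
  good := h.good.comp_neg
  lintegral_eq {g} hg := by
    have := h.lintegral_eq (g := fun y => g (-y)) (by fun_prop)
    rw [← lintegral_neg_eq_self (fun y => ENNReal.ofReal (f y) * g (-y))] at this
    simpa [Finset.sum_neg_distrib] using this

theorem map_eq (h : HasSumDensity a f C) : Measure.map (fun x => ∑ i, a i * x i) (expPi n)
    = volume.withDensity fun x => ENNReal.ofReal (f x) := by
  ext s hs
  have := h.lintegral_eq (g := s.indicator 1) (measurable_one.indicator hs)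
  rw [← lintegral_map (measurable_one.indicator hs) (by fun_prop),
    lintegral_indicator_one hs] at this
  rw [this, withDensity_apply _ hs, ← lintegral_indicator hs]
  refine lintegral_congr fun y => ?_
  by_cases hy : y ∈ s <;> simp [hy]

theorem apply_le_of_isExpSumDensity (h : HasSumDensity a f C) {p : ℝ → ℝ}
    (hp : IsExpSumDensity a p) (x : ℝ) : p x ≤ f x := by
  have e := hp.2.symm.trans h.map_eq
  rw [withDensity_eq_iff_of_sigmaFinite (by have := hp.1.measurable; fun_prop)
    (by have := h.good.cont.measurable; fun_prop)] at e
  have hcp : Continuous fun x => ENNReal.ofReal (p x) := ENNReal.continuous_ofReal.comp hp.1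
  have hcf : Continuous fun x => ENNReal.ofReal (f x) :=
    ENNReal.continuous_ofReal.comp h.good.cont
  have := congrFun ((hcp.ae_eq_iff_eq _ hcf).1 e) x
  exact (ENNReal.ofReal_le_ofReal_iff (h.good.nonneg x)).1 this.le

theorem mul_lintegral_le (h : HasSumDensity a f C) {w : ℝ → ℝ≥0∞} (hw : Measurable w) :
    ENNReal.ofReal (f 0) * ∫⁻ x in Ioi 0, ENNReal.ofReal (f x) * ∫⁻ y in Ioc 0 x, w y
      ≤ (∫⁻ x in Ioi 0, ENNReal.ofReal (f x)) * ∫⁻ y in Ioi 0, ENNReal.ofReal (f y) * w y := by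
  have hfm := h.good.cont.measurable
  have tail : ∀ y, 0 < y → ENNReal.ofReal (f 0) * ∫⁻ x in Ioi y, ENNReal.ofReal (f x)
      ≤ (∫⁻ x in Ioi 0, ENNReal.ofReal (f x)) * ENNReal.ofReal (f y) := by
    intro y hy
    have e := (measurePreserving_add_right volume y).setLIntegral_comp_preimage_emb
      (measurableEmbedding_addRight y) (fun x => ENNReal.ofReal (f x)) (Ioi y)
    rw [preimage_add_const_Ioi, sub_self] at e
    rw [← e, ← lintegral_const_mul _ (by fun_prop), ← lintegral_mul_const _ (by fun_prop)]
    refine setLIntegral_mono (by fun_prop) fun x hx => ?_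
    rw [← ENNReal.ofReal_mul (h.good.nonneg _), ← ENNReal.ofReal_mul (h.good.nonneg _)]
    refine ENNReal.ofReal_le_ofReal ?_
    have := h.good.pf2 0 x y (le_of_lt hx) hy.le
    rw [zero_add] at this
    linarith
  have swap : ∫⁻ x in Ioi 0, ENNReal.ofReal (f x) * ∫⁻ y in Ioc 0 x, w y
      = ∫⁻ y in Ioi 0, w y * ∫⁻ x in Ici y, ENNReal.ofReal (f x) := by
    have e1 : ∀ x ∈ Ioi (0 : ℝ), ENNReal.ofReal (f x) * ∫⁻ y in Ioc 0 x, w y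
        = ∫⁻ y in Ioi 0, {q : ℝ × ℝ | q.2 ≤ q.1}.indicator
          (fun q => ENNReal.ofReal (f q.1) * w q.2) (x, y) := by
      intro x hx
      rw [← lintegral_const_mul _ hw, ← Ioi_inter_Iic, inter_comm,
        ← setLIntegral_indicator measurableSet_Iic]
      rfl
    have e2 : ∀ y ∈ Ioi (0 : ℝ), w y * ∫⁻ x in Ici y, ENNReal.ofReal (f x)
        = ∫⁻ x in Ioi 0, {q : ℝ × ℝ | q.2 ≤ q.1}.indicator
          (fun q => ENNReal.ofReal (f q.1) * w q.2) (x, y) := by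
      intro y hy
      have : Ici y ∩ Ioi 0 = Ici y := inter_eq_left.2 fun x hx =>
        mem_Ioi.2 (lt_of_lt_of_le (mem_Ioi.1 hy) (mem_Ici.1 hx))
      rw [← lintegral_const_mul _ (by fun_prop), ← this, ← setLIntegral_indicator measurableSet_Ici]
      refine lintegral_congr fun x => ?_
      simp only [indicator, mem_Ici, mem_ofPred_eq, mul_comm (w y)]
    rw [setLIntegral_congr_fun measurableSet_Ioi e1, setLIntegral_congr_fun measurableSet_Ioi e2]
    refine lintegral_lintegral_swap (Measurable.aemeasurable ?_)
    exact Measurable.indicator (by fun_prop) (measurableSet_le measurable_snd measurable_fst)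
  have hIci : ∀ y, ∫⁻ x in Ici y, ENNReal.ofReal (f x) = ∫⁻ x in Ioi y, ENNReal.ofReal (f x) :=
    fun y => setLIntegral_congr Ioi_ae_eq_Ici.symm
  have hmeas : Measurable fun y => ∫⁻ x in Ioi y, ENNReal.ofReal (f x) := by
    have : Antitone fun y => ∫⁻ x in Ioi y, ENNReal.ofReal (f x) := fun y z hyz =>
      lintegral_mono_set (Ioi_subset_Ioi hyz)
    exact this.measurable
  simp only [hIci] at swap
  rw [swap, ← lintegral_const_mul _ (by fun_prop), ← lintegral_const_mul _ (by fun_prop)]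
  refine setLIntegral_mono (by fun_prop) fun y hy => ?_
  calc _ = w y * (ENNReal.ofReal (f 0) * ∫⁻ x in Ioi y, ENNReal.ofReal (f x)) := by ring
    _ ≤ w y * ((∫⁻ x in Ioi 0, ENNReal.ofReal (f x)) * ENNReal.ofReal (f y)) := by
      exact mul_le_mul_right (tail y hy) _
    _ = _ := by ring

theorem ofReal_integral_indIoi (h : HasSumDensity a f C) {g : ℝ → ℝ} (hg : Measurable g)
    (hg0 : ∀ x, 0 < x → 0 ≤ g x)
    (hi : Integrable (fun x => indIoi (∑ i, a i * x i) * g (∑ i, a i * x i)) (expPi n)) :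
    ENNReal.ofReal (∫ x, indIoi (∑ i, a i * x i) * g (∑ i, a i * x i) ∂expPi n)
      = ∫⁻ y in Ioi 0, ENNReal.ofReal (f y) * ENNReal.ofReal (g y) := by
  have key : ∀ y, 0 ≤ indIoi y * g y := by
    intro y
    by_cases hy : 0 < y
    · rw [indIoi_of_pos hy, one_mul]; exact hg0 y hy
    · rw [indIoi_of_nonpos (not_lt.1 hy), zero_mul]
  rw [ofReal_integral_eq_lintegral_ofReal hi (Eventually.of_forall fun x => key _),
    h.lintegral_eq (g := fun y => ENNReal.ofReal (indIoi y * g y)) (by fun_prop),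
    ← lintegral_indicator measurableSet_Ioi]
  refine lintegral_congr fun y => ?_
  by_cases hy : 0 < y
  · simp [hy, indIoi_of_pos]
  · simp [hy, indIoi_of_nonpos (not_lt.1 hy)]

/-- The new-better-than-used inequality for the restriction of `f` to the positive half-line. -/
theorem apply_zero_mul_integral_le (h : HasSumDensity a f C) {w W : ℝ → ℝ} (hw : Continuous w)
    (hw0 : ∀ x, 0 < x → 0 ≤ w x) (hW0 : W 0 = 0) (hW : ∀ x, HasDerivAt W (w x) x)
    (hiw : Integrable (fun x => indIoi (∑ i, a i * x i) * w (∑ i, a i * x i)) (expPi n))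
    (hiW : Integrable (fun x => indIoi (∑ i, a i * x i) * W (∑ i, a i * x i)) (expPi n)) :
    f 0 * ∫ x, indIoi (∑ i, a i * x i) * W (∑ i, a i * x i) ∂expPi n
      ≤ (∫ x, indIoi (∑ i, a i * x i) ∂expPi n)
        * ∫ x, indIoi (∑ i, a i * x i) * w (∑ i, a i * x i) ∂expPi n := by
  have hWm : Measurable W := (continuous_iff_continuousAt.2 fun x => (hW x).continuousAt).measurable
  have hint : ∀ x, 0 < x → ∫ y in Ioc 0 x, w y = W x := by
    intro x hx
    rw [← intervalIntegral.integral_of_le hx.le, intervalIntegral.integral_eq_sub_of_hasDerivAt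
      (fun y _ => hW y) (hw.intervalIntegrable _ _), hW0, sub_zero]
  have hlint : ∀ x ∈ Ioi (0 : ℝ), ENNReal.ofReal (f x) * ENNReal.ofReal (W x)
      = ENNReal.ofReal (f x) * ∫⁻ y in Ioc 0 x, ENNReal.ofReal (w y) := by
    intro x hx
    rw [← hint x hx, ofReal_integral_eq_lintegral_ofReal
      (hw.integrableOn_Icc.mono_set Ioc_subset_Icc_self)]
    filter_upwards [ae_restrict_mem measurableSet_Ioc] with y hy using hw0 y hy.1
  have hW0' : ∀ x, 0 < x → 0 ≤ W x := fun x hx => by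
    rw [← hint x hx]
    exact setIntegral_nonneg measurableSet_Ioc fun y hy => hw0 y hy.1
  have hind : ∀ y, 0 ≤ indIoi y := fun y => indicator_nonneg (fun _ _ => zero_le_one) _
  have hone : Integrable (fun x => indIoi (∑ i, a i * x i) * 1) (expPi n) := by
    simp only [mul_one]
    exact integrable_of_abs_le (by fun_prop) fun _ => abs_indIoi_le _
  have e1 := h.ofReal_integral_indIoi (g := fun _ => 1) measurable_const (by simp) hone
  simp only [mul_one, ENNReal.ofReal_one] at e1
  have hnn : 0 ≤ ∫ x, indIoi (∑ i, a i * x i) ∂expPi n := integral_nonneg fun x => hind _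
  have hnn' : 0 ≤ ∫ x, indIoi (∑ i, a i * x i) * w (∑ i, a i * x i) ∂expPi n := by
    refine integral_nonneg fun x => ?_
    simp only [Pi.zero_apply]
    by_cases hy : 0 < ∑ i, a i * x i
    · exact mul_nonneg (hind _) (hw0 _ hy)
    · rw [indIoi_of_nonpos (not_lt.1 hy), zero_mul]
  rw [← ENNReal.ofReal_le_ofReal_iff (mul_nonneg hnn hnn'), ENNReal.ofReal_mul (h.good.nonneg _),
    ENNReal.ofReal_mul hnn, e1, h.ofReal_integral_indIoi hWm hW0' hiW,
    h.ofReal_integral_indIoi hw.measurable hw0 hiw, setLIntegral_congr_fun measurableSet_Ioi hlint]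
  exact h.mul_lintegral_le (w := fun y => ENNReal.ofReal (w y))
    (ENNReal.measurable_ofReal.comp hw.measurable)

end HasSumDensity

/-! ### Stein identities for linear combinations of exponentials -/

theorem indIoi_nonneg (y : ℝ) : 0 ≤ indIoi y := indicator_nonneg (fun _ _ => zero_le_one) _

theorem integrable_indIoi_mul {α : Type*} [MeasurableSpace α] {μ : Measure α} {g h : α → ℝ}
    (hh : Measurable h) (hg : Integrable g μ) : Integrable (fun x => indIoi (h x) * g x) μ := by
  simpa only [mul_comm, Function.comp_apply] using
    integrable_mul_indicator_of_bounded hg (measurable_indIoi.comp hh) 1 fun x => abs_indIoi_le _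

theorem expIoi_eq (r y : ℝ) : expIoi r y = indIoi y * exp (-(y / r)) := by
  by_cases hy : 0 < y
  · rw [expIoi_of_pos r hy, indIoi_of_pos hy, one_mul]
  · rw [expIoi_of_nonpos r (not_lt.1 hy), indIoi_of_nonpos (not_lt.1 hy), zero_mul]

theorem expIio_eq (r y : ℝ) : expIio r y = expIoi r (-y) := by
  by_cases hy : y < 0
  · rw [expIio_of_neg r hy, expIoi_of_pos r (neg_pos.2 hy), neg_div, neg_neg]
  · rw [expIio_of_nonneg r (not_lt.1 hy), expIoi_of_nonpos r (by linarith)]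

theorem max_zero_eq (y : ℝ) : max y 0 = indIoi y * y := by
  by_cases hy : 0 < y
  · rw [indIoi_of_pos hy, one_mul, max_eq_left hy.le]
  · rw [indIoi_of_nonpos (not_lt.1 hy), zero_mul, max_eq_right (not_lt.1 hy)]

/-- The probability that a linear combination of exponentials is positive. -/
noncomputable def probPos {n : ℕ} (a : Fin n → ℝ) : ℝ := ∫ x, indIoi (∑ i, a i * x i) ∂expPi n

/-- The mean of the positive part of a linear combination of exponentials. -/
noncomputable def meanPos {n : ℕ} (a : Fin n → ℝ) : ℝ :=
  ∫ x, indIoi (∑ i, a i * x i) * ∑ i, a i * x i ∂expPi n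

/-- Half of the second moment of the positive part of a linear combination of exponentials. -/
noncomputable def halfSqPos {n : ℕ} (a : Fin n → ℝ) : ℝ :=
  ∫ x, indIoi (∑ i, a i * x i) * ((∑ i, a i * x i) ^ 2 / 2) ∂expPi n

/-- The Laplace transform at `1 / r` of the positive half of a linear combination of
exponentials. -/
noncomputable def laplacePos {n : ℕ} (a : Fin n → ℝ) (r : ℝ) : ℝ :=
  ∫ x, expIoi r (∑ i, a i * x i) ∂expPi n

section Integrability

variable {n : ℕ} (a : Fin n → ℝ)

theorem integrable_indIoi_sum : Integrable (fun x => indIoi (∑ i, a i * x i)) (expPi n) :=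
  integrable_of_abs_le (by fun_prop) fun _ => abs_indIoi_le _

theorem integrable_sum_expPi : Integrable (fun x => ∑ i, a i * x i) (expPi n) := by
  simpa using MemLp.integrable_pow_of_ne_zero one_ne_zero (memLp_sum_expPi a one_ne_zero)

theorem integrable_sum_sq_expPi : Integrable (fun x => (∑ i, a i * x i) ^ 2) (expPi n) :=
  MemLp.integrable_pow_of_ne_zero two_ne_zero (memLp_sum_expPi a two_ne_zero)

theorem integrable_eval_expPi (j : Fin n) : Integrable (fun x : Fin n → ℝ => x j) (expPi n) := by
  simpa using MemLp.integrable_pow_of_ne_zero one_ne_zero (memLp_eval_expPi j one_ne_zero)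

theorem integrable_eval_mul_sum_expPi (j : Fin n) :
    Integrable (fun x : Fin n → ℝ => x j * ∑ i, a i * x i) (expPi n) := by
  have h1 := memLp_eval_expPi j two_ne_zero
  have h2 := memLp_sum_expPi a two_ne_zero
  norm_cast at h1 h2
  exact h1.integrable_mul h2

end Integrability

theorem probPos_nonneg {n : ℕ} (a : Fin n → ℝ) : 0 ≤ probPos a :=
  integral_nonneg fun _ => indIoi_nonneg _

namespace HasSumDensity

variable {n : ℕ} {a : Fin n → ℝ} {f : ℝ → ℝ} {C : ℝ}

theorem apply_zero_mul_meanPos_le (h : HasSumDensity a f C) :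
    f 0 * meanPos a ≤ probPos a * probPos a := by
  have := h.apply_zero_mul_integral_le (w := fun _ => 1) (W := fun x => x) continuous_const
    (by simp) rfl (fun x => hasDerivAt_id x) (by simpa using integrable_indIoi_sum a)
    (integrable_indIoi_mul (by fun_prop) (integrable_sum_expPi a))
  simpa [meanPos, probPos] using this

theorem apply_zero_mul_halfSqPos_le (h : HasSumDensity a f C) :
    f 0 * halfSqPos a ≤ probPos a * meanPos a := by
  refine h.apply_zero_mul_integral_le (w := fun x => x) (W := fun x => x ^ 2 / 2) continuous_id
    (fun x hx => hx.le) (by simp) (fun x => ?_)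
    (integrable_indIoi_mul (by fun_prop) (integrable_sum_expPi a))
    (integrable_indIoi_mul (by fun_prop) ((integrable_sum_sq_expPi a).div_const 2))
  exact (((hasDerivAt_id' x).pow 2).div_const 2).congr_deriv (by simp)

theorem apply_zero_mul_probPos_sub_le (h : HasSumDensity a f C) {r : ℝ} (hr : 0 < r) :
    f 0 * (r * (probPos a - laplacePos a r)) ≤ probPos a * laplacePos a r := by
  have hi : Integrable (fun x => expIoi r (∑ i, a i * x i)) (expPi n) :=
    integrable_of_abs_le (by fun_prop) fun _ => abs_expIoi_le hr _
  have hW : ∀ y, indIoi y * (r * (1 - exp (-(y / r)))) = r * (indIoi y - expIoi r y) := by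
    intro y; rw [expIoi_eq]; ring
  have hiW : Integrable (fun x => indIoi (∑ i, a i * x i)
      * (r * (1 - exp (-((∑ i, a i * x i) / r))))) (expPi n) := by
    simp only [hW]
    exact ((integrable_indIoi_sum a).sub hi).const_mul r
  have := h.apply_zero_mul_integral_le (w := fun x => exp (-(x / r)))
    (W := fun x => r * (1 - exp (-(x / r)))) (by fun_prop)
    (fun x _ => (exp_pos _).le) (by simp) (fun x => ?_) (by simpa only [expIoi_eq] using hi) hiW
  · simp only [hW, ← expIoi_eq] at this
    rwa [integral_const_mul, integral_sub (integrable_indIoi_sum a) hi] at this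
  · have hd : HasDerivAt (fun x => -(x / r)) (-(1 / r)) x := ((hasDerivAt_id' x).div_const r).neg
    exact ((hd.exp.const_sub 1).const_mul r).congr_deriv (by field_simp)

theorem probPos_add_probPos_neg (h : HasSumDensity a f C) :
    probPos a + probPos (fun i => -a i) = 1 := by
  have h0 : ∀ᵐ x ∂expPi n, ∑ i, a i * x i ≠ 0 := by
    have : ∀ᵐ y ∂Measure.map (fun x => ∑ i, a i * x i) (expPi n), y ≠ 0 := by
      rw [h.map_eq]
      exact withDensity_absolutelyContinuous _ _ (compl_mem_ae_iff.2 (measure_singleton _))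
    have hm : Measurable fun x : Fin n → ℝ => ∑ i, a i * x i := by fun_prop
    exact ae_of_ae_map hm.aemeasurable this
  unfold probPos
  rw [← integral_add (integrable_indIoi_sum _) (integrable_indIoi_sum _)]
  trans ∫ _, 1 ∂expPi n
  · refine integral_congr_ae ?_
    filter_upwards [h0] with x hx
    simp only [neg_mul, Finset.sum_neg_distrib]
    rcases lt_or_gt_of_ne hx with hx | hx
    · rw [indIoi_of_nonpos hx.le, indIoi_of_pos (neg_pos.2 hx), zero_add]
    · rw [indIoi_of_nonpos (neg_nonpos.2 hx.le), indIoi_of_pos hx, add_zero]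
  · simp

end HasSumDensity

theorem sum_centered {n : ℕ} {a : Fin n → ℝ} (ha : ∑ i, a i = 0) (x : Fin n → ℝ) :
    ∑ i, a i * (x i - 1) = ∑ i, a i * x i := by
  simp [mul_sub, Finset.sum_sub_distrib, ha]

theorem meanPos_neg {n : ℕ} {a : Fin n → ℝ} (ha : ∑ i, a i = 0) :
    meanPos (fun i => -a i) = meanPos a := by
  have h := (moments_centered_sum a).2.1
  simp only [sum_centered ha] at h
  have hi := fun b : Fin n → ℝ => integrable_indIoi_mul (h := fun x => ∑ i, b i * x i)
    (by fun_prop) (integrable_sum_expPi b)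
  rw [eq_comm, ← sub_eq_zero, meanPos, meanPos, ← integral_sub (hi _) (hi _), ← h]
  refine integral_congr_ae (Eventually.of_forall fun x => ?_)
  simp only [neg_mul, Finset.sum_neg_distrib]
  rcases le_total (∑ i, a i * x i) 0 with hx | hx
  · rw [← max_zero_eq, ← max_zero_eq, max_eq_right hx, max_eq_left (neg_nonneg.2 hx)]; ring
  · rw [← max_zero_eq, ← max_zero_eq, max_eq_left hx, max_eq_right (neg_nonpos.2 hx)]; ring

theorem halfSqPos_add_neg {n : ℕ} {a : Fin n → ℝ} (ha : ∑ i, a i = 0) (ha2 : ∑ i, a i ^ 2 = 1) :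
    halfSqPos a + halfSqPos (fun i => -a i) = 1 / 2 := by
  have h := (moments_centered_sum a).2.2.1
  simp only [sum_centered ha, ha2] at h
  have hi := fun b : Fin n → ℝ => integrable_indIoi_mul (h := fun x => ∑ i, b i * x i)
    (by fun_prop) ((integrable_sum_sq_expPi b).div_const 2)
  rw [halfSqPos, halfSqPos, ← integral_add (hi _) (hi _), ← h, ← integral_div]
  refine integral_congr_ae (Eventually.of_forall fun x => ?_)
  simp only [neg_mul, Finset.sum_neg_distrib]
  rcases lt_trichotomy (∑ i, a i * x i) 0 with hx | hx | hx
  · rw [indIoi_of_nonpos hx.le, indIoi_of_pos (neg_pos.2 hx)]; ring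
  · simp [hx]
  · rw [indIoi_of_nonpos (neg_nonpos.2 hx.le), indIoi_of_pos hx]; ring

/-- The Stein weight `|aⱼ| E[exp(-|X| / |aⱼ|); aⱼ X < 0]`. -/
noncomputable def steinWeight {n : ℕ} (a : Fin n → ℝ) (j : Fin n) : ℝ :=
  if 0 < a j then a j * laplacePos (fun i => -a i) (a j)
  else if a j < 0 then -a j * laplacePos a (-a j) else 0

theorem mul_integral_sub_one_mul_indIoi {n : ℕ} (a : Fin (n + 1) → ℝ) (j : Fin (n + 1)) :
    a j * ∫ x, (x j - 1) * indIoi (∑ i, a i * x i) ∂expPi (n + 1) = steinWeight a j := by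
  have hi : Integrable (fun x => (x j - 1) * indIoi (∑ i, a i * x i)) (expPi (n + 1)) :=
    integrable_mul_indicator_of_bounded ((integrable_eval_expPi j).sub (integrable_const 1))
      (by fun_prop) 1 fun x => abs_indIoi_le _
  unfold steinWeight
  split_ifs with h1 h2
  · have := integral_expPi_congr_coord j a (g₁ := fun t y => (t - 1) * indIoi y)
      (g₂ := fun _ y => expIio (a j) y) hi
      (integrable_of_abs_le (by fun_prop) fun _ => abs_expIio_le h1 _)
      (integral_sub_one_mul_indIoi_of_pos h1)
    rw [this, laplacePos]
    simp only [expIio_eq, neg_mul, Finset.sum_neg_distrib]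
  · have hh := integral_sub_one_mul_indIoi_of_neg (neg_pos.2 h2)
    rw [neg_neg] at hh
    have := integral_expPi_congr_coord j a (g₁ := fun t y => (t - 1) * indIoi y)
      (g₂ := fun _ y => -expIoi (-a j) y) hi
      (integrable_of_abs_le (by fun_prop) fun _ => abs_expIoi_le (neg_pos.2 h2) _).neg
      (fun r => by rw [hh, integral_neg])
    rw [this, laplacePos, integral_neg]
    ring
  · rw [show a j = 0 by linarith, zero_mul]

theorem integral_eval_mul_indIoi {n : ℕ} (a : Fin (n + 1) → ℝ) (j : Fin (n + 1)) :
    a j * ∫ x, x j * indIoi (∑ i, a i * x i) ∂expPi (n + 1)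
      = a j * probPos a + steinWeight a j := by
  rw [← mul_integral_sub_one_mul_indIoi, probPos, ← mul_add, ← integral_add]
  · congr 2; funext x; ring
  · exact integrable_indIoi_sum a
  · exact integrable_mul_indicator_of_bounded ((integrable_eval_expPi j).sub (integrable_const 1))
      (by fun_prop) 1 fun x => abs_indIoi_le _

theorem meanPos_eq_sum_steinWeight {n : ℕ} {a : Fin (n + 1) → ℝ} (ha : ∑ i, a i = 0) :
    meanPos a = ∑ j, steinWeight a j := by
  have hi : ∀ j, Integrable (fun x : Fin (n + 1) → ℝ => x j * indIoi (∑ i, a i * x i))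
      (expPi (n + 1)) := fun j => integrable_mul_indicator_of_bounded (integrable_eval_expPi j)
      (by fun_prop) 1 fun x => abs_indIoi_le _
  have : ∀ x : Fin (n + 1) → ℝ, indIoi (∑ i, a i * x i) * ∑ i, a i * x i
      = ∑ j, a j * (x j * indIoi (∑ i, a i * x i)) := by
    intro x; rw [mul_comm, Finset.sum_mul]; simp only [mul_assoc]
  rw [meanPos]
  simp only [this]
  rw [integral_finsetSum _ fun j _ => (hi j).const_mul _]
  simp only [integral_const_mul, integral_eval_mul_indIoi]
  rw [Finset.sum_add_distrib, ← Finset.sum_mul, ha, zero_mul, zero_add]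

theorem sum_mul_steinWeight {n : ℕ} {a : Fin (n + 1) → ℝ} (ha : ∑ i, a i = 0)
    (ha2 : ∑ i, a i ^ 2 = 1) :
    ∑ j, a j * steinWeight a j = 2 * halfSqPos a - probPos a := by
  have hi : ∀ j, Integrable (fun x : Fin (n + 1) → ℝ => (x j - 1) * max (∑ i, a i * x i) 0)
      (expPi (n + 1)) := fun j => by
    have h1 : Integrable (fun x : Fin (n + 1) → ℝ => (x j - 1) * ∑ i, a i * x i)
        (expPi (n + 1)) := by
      simp only [sub_mul, one_mul]
      exact (integrable_eval_mul_sum_expPi a j).sub (integrable_sum_expPi a)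
    refine (integrable_indIoi_mul (h := fun x => ∑ i, a i * x i) (by fun_prop) h1).congr
      (Eventually.of_forall fun x => ?_)
    simp only [max_zero_eq]
    ring
  have hi' : ∀ j, Integrable (fun x : Fin (n + 1) → ℝ => a j * (x j * indIoi (∑ i, a i * x i)))
      (expPi (n + 1)) := fun j => (integrable_mul_indicator_of_bounded (integrable_eval_expPi j)
      (by fun_prop) 1 fun x => abs_indIoi_le _).const_mul _
  have this : ∀ x : Fin (n + 1) → ℝ, indIoi (∑ i, a i * x i) * ((∑ i, a i * x i) ^ 2 / 2)
      = (∑ j, a j * ((x j - 1) * max (∑ i, a i * x i) 0)) / 2 := by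
    intro x
    simp only [← mul_assoc]
    rw [← Finset.sum_mul, sum_centered ha, max_zero_eq]
    ring
  have e : ∀ j, ∫ x, (x j - 1) * max (∑ i, a i * x i) 0 ∂expPi (n + 1)
      = a j * ∫ x, x j * indIoi (∑ i, a i * x i) ∂expPi (n + 1) := by
    intro j
    rw [← integral_const_mul]
    exact integral_expPi_congr_coord j a (g₁ := fun t y => (t - 1) * max y 0)
      (g₂ := fun t y => a j * (t * indIoi y)) (hi j) (hi' j)
      (integral_sub_one_mul_posPart (a j))
  rw [halfSqPos]
  simp only [this]
  rw [integral_div, integral_finsetSum _ fun j _ => (hi j).const_mul _]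
  simp only [integral_const_mul, e, integral_eval_mul_indIoi]
  have : ∑ j, a j * (a j * probPos a + steinWeight a j)
      = (∑ j, a j ^ 2) * probPos a + ∑ j, a j * steinWeight a j := by
    rw [Finset.sum_mul, ← Finset.sum_add_distrib]
    exact Finset.sum_congr rfl fun j _ => by ring
  rw [this, ha2]
  ring

/-! ### The global estimate -/

theorem laplacePos_nonneg {n : ℕ} (a : Fin n → ℝ) (r : ℝ) : 0 ≤ laplacePos a r :=
  integral_nonneg fun _ => indicator_nonneg (fun _ _ => (exp_pos _).le) _

theorem steinWeight_nonneg {n : ℕ} (a : Fin n → ℝ) (j : Fin n) : 0 ≤ steinWeight a j := by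
  unfold steinWeight
  split_ifs with h1 h2
  · exact mul_nonneg h1.le (laplacePos_nonneg _ _)
  · exact mul_nonneg (by linarith) (laplacePos_nonneg _ _)
  · exact le_rfl

theorem mul_sq_le_of_mul_sq_le {m B c x w : ℝ} (hm : 0 ≤ m) (hmB : m ≤ B) (hB : 0 < B) (hc : 0 ≤ c)
    (hx : 0 ≤ x) (hw : 0 ≤ w) (h : c * x ^ 2 * B ≤ (B + c * x) * w) :
    m * (c * x ^ 2) ≤ (m + c * x) * w := by
  have h1 : 0 ≤ w * (c * x) * (B - m) :=
    mul_nonneg (mul_nonneg hw (mul_nonneg hc hx)) (by linarith)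
  have h2 : B * (m * (c * x ^ 2)) ≤ B * ((m + c * x) * w) := by
    nlinarith [mul_le_mul_of_nonneg_left h hm]
  exact le_of_mul_le_mul_left h2 hB

namespace HasSumDensity

variable {n : ℕ} {a : Fin (n + 1) → ℝ} {f : ℝ → ℝ} {C : ℝ}

theorem mul_sq_le_steinWeight (h : HasSumDensity a f C) {m : ℝ} (hm : 0 < m)
    (hA : m ≤ probPos a) (hB : m ≤ probPos fun i => -a i) (j : Fin (n + 1)) :
    m * (f 0 * a j ^ 2) ≤ (m + f 0 * |a j|) * steinWeight a j := by
  have hw := steinWeight_nonneg a j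
  rcases lt_trichotomy (a j) 0 with hj | hj | hj
  · rw [← sq_abs]
    refine mul_sq_le_of_mul_sq_le hm.le hA (by linarith) (h.good.nonneg _) (abs_nonneg _) hw ?_
    have := mul_le_mul_of_nonneg_left (h.apply_zero_mul_probPos_sub_le (neg_pos.2 hj))
      (neg_pos.2 hj).le
    rw [steinWeight, if_neg (not_lt.2 hj.le), if_pos hj, abs_of_neg hj]
    linarith
  · simp [hj, steinWeight]
  · rw [← sq_abs]
    refine mul_sq_le_of_mul_sq_le hm.le hB (by linarith) (h.good.nonneg _) (abs_nonneg _) hw ?_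
    have := mul_le_mul_of_nonneg_left (h.neg.apply_zero_mul_probPos_sub_le hj) hj.le
    rw [neg_zero] at this
    rw [steinWeight, if_pos hj, abs_of_pos hj]
    linarith

/-- If the density at the origin is almost maximal, then the two extreme coefficients carry almost
all of the mass. -/
theorem le_add_of_le_apply_zero (h : HasSumDensity a f C) (ha : ∑ i, a i = 0)
    (ha2 : ∑ i, a i ^ 2 = 1) {u v : ℝ} (hu : 0 < u) (hv : 0 < v) (hau : ∀ j, a j ≤ u)
    (hav : ∀ j, -v ≤ a j) (hc : 0.70707 ≤ f 0) : 1.4129 ≤ u + v := by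
  set c := f 0 with hc'
  set M := meanPos a
  set A := probPos a
  set B := probPos fun i => -a i
  set R := halfSqPos a
  have hM1 : c * M ≤ A * A := h.apply_zero_mul_meanPos_le
  have hM2 : c * M ≤ B * B := by
    simpa [meanPos_neg ha] using h.neg.apply_zero_mul_meanPos_le
  have hR1 : c * R ≤ A * M := h.apply_zero_mul_halfSqPos_le
  have hR2 : c * (1 / 2 - R) ≤ B * M := by
    rw [← halfSqPos_add_neg ha ha2, add_sub_cancel_left]
    simpa [meanPos_neg ha] using h.neg.apply_zero_mul_halfSqPos_le
  have hAB : A + B = 1 := h.probPos_add_probPos_neg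
  have hA0 : 0 ≤ A := probPos_nonneg a
  have hB0 : 0 ≤ B := probPos_nonneg _
  have hc0 : 0 < c := by linarith
  have hMc : c ≤ 2 * M := by
    have : (A + B) * M = M := by rw [hAB, one_mul]
    linarith
  set m := min A B with hm
  have hmA : m ≤ A := min_le_left _ _
  have hmB : m ≤ B := min_le_right _ _
  have hmm : c * M ≤ m * m := by
    rcases min_choice A B with h' | h' <;> rw [hm, h'] <;> assumption
  have hm0 : 0 ≤ m := le_min hA0 hB0
  have hm2 : m ≤ 1 / 2 := by linarith
  have hm1 : 0.49997 ≤ m := by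
    have h1 : c * c ≤ c * (2 * M) := mul_le_mul_of_nonneg_left hMc hc0.le
    have h2 : 0.70707 * 0.70707 ≤ c * c := mul_le_mul hc hc (by norm_num) hc0.le
    by_contra! h3
    have h4 : m * m ≤ 0.49997 * 0.49997 := mul_le_mul h3.le h3.le hm0 (by norm_num)
    linarith
  have hsum : ∀ j, m * (c * a j ^ 2) ≤ (m + c * |a j|) * steinWeight a j :=
    h.mul_sq_le_steinWeight (by linarith) hmA hmB
  have hwM : ∑ j, steinWeight a j = M := (meanPos_eq_sum_steinWeight ha).symm
  have hD := sum_mul_steinWeight ha ha2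
  set Q := ∑ j, |a j| * steinWeight a j with hQ
  have hQ1 : m * c ≤ m * M + c * Q := by
    have := Finset.sum_le_sum fun j (_ : j ∈ Finset.univ) => hsum j
    rw [← Finset.mul_sum, ← Finset.mul_sum, ha2] at this
    simp only [add_mul, Finset.sum_add_distrib, mul_assoc] at this
    rw [← Finset.mul_sum, ← Finset.mul_sum, hwM] at this
    linarith
  have hQ2 : (Q + (2 * R - A)) / 2 / u + (Q - (2 * R - A)) / 2 / v ≤ M := by
    rw [← hD, hQ, ← Finset.sum_add_distrib, ← Finset.sum_sub_distrib, ← hwM, Finset.sum_div,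
      Finset.sum_div, Finset.sum_div, Finset.sum_div, ← Finset.sum_add_distrib]
    refine Finset.sum_le_sum fun j _ => ?_
    have hw := steinWeight_nonneg a j
    rcases le_total (a j) 0 with hj | hj
    · rw [abs_of_nonpos hj]
      have : -a j / v * steinWeight a j ≤ 1 * steinWeight a j := by
        refine mul_le_mul_of_nonneg_right ?_ hw
        rw [div_le_one hv]; linarith [hav j]
      calc _ = -a j / v * steinWeight a j := by ring
        _ ≤ _ := by linarith
    · rw [abs_of_nonneg hj]
      have : a j / u * steinWeight a j ≤ 1 * steinWeight a j := by
        refine mul_le_mul_of_nonneg_right ?_ hw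
        rw [div_le_one hu]; linarith [hau j]
      calc _ = a j / u * steinWeight a j := by ring
        _ ≤ _ := by linarith
  have hM0 : 0 ≤ M := by linarith
  have hM5 : 0.70707 * M ≤ 1 / 4 := by
    have h1 : 0.70707 * M ≤ c * M := mul_le_mul_of_nonneg_right hc hM0
    have h2 : m * m ≤ 1 / 2 * (1 / 2) := mul_le_mul hm2 hm2 hm0 (by norm_num)
    linarith
  have hM3 : M ≤ 0.35358 := by linarith
  have hM4 : M ≤ 0.50006 * c := by linarith
  have hQ3 : 0.24994 ≤ Q := by
    have h1 : m * M ≤ m * (0.50006 * c) := mul_le_mul_of_nonneg_left hM4 hm0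
    have h2 : c * (0.49994 * m) ≤ c * Q := by linarith
    linarith [le_of_mul_le_mul_left h2 hc0]
  have hA1 : A ≤ 0.50003 := by linarith
  have hB1 : B ≤ 0.50003 := by linarith
  have hR3 : R ≤ 0.50006 * A := by
    have : c * R ≤ c * (0.50006 * A) := by
      linarith [mul_le_mul_of_nonneg_left hM4 hA0]
    exact le_of_mul_le_mul_left this hc0
  have hR4 : 1 / 2 - R ≤ 0.50006 * B := by
    have : c * (1 / 2 - R) ≤ c * (0.50006 * B) := by
      linarith [mul_le_mul_of_nonneg_left hM4 hB0]
    exact le_of_mul_le_mul_left this hc0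
  have hq1 : 0.1249 ≤ (Q + (2 * R - A)) / 2 := by linarith
  have hq2 : 0.1249 ≤ (Q - (2 * R - A)) / 2 := by linarith
  have hfin : 0.1249 / u + 0.1249 / v ≤ M := by
    refine le_trans ?_ hQ2
    gcongr
  have huv : 0.1249 * (u + v) ≤ M * (u * v) := by
    have : 0.1249 / u + 0.1249 / v = 0.1249 * (u + v) / (u * v) := by field_simp; ring
    rwa [this, div_le_iff₀ (by positivity)] at hfin
  have : u * v ≤ (u + v) ^ 2 / 4 := by nlinarith [sq_nonneg (u - v)]
  have h4 : 0.1249 * (u + v) ≤ 0.35358 * ((u + v) ^ 2 / 4) := by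
    refine huv.trans ?_
    gcongr
  have h5 : 0.1249 ≤ 0.35358 * ((u + v) / 4) := by
    have hs : 0 < u + v := by linarith
    refine le_of_mul_le_mul_right ?_ hs
    linarith
  linarith

end HasSumDensity

/-! ### The local estimate -/

theorem sum_eq_centered_add {k : ℕ} (b z : Fin k → ℝ) :
    ∑ i, b i * z i = ∑ i, b i * (z i - 1) + ∑ i, b i := by
  rw [← Finset.sum_add_distrib]
  exact Finset.sum_congr rfl fun i _ => by ring

theorem hasIntegralValue_sum_sq {k : ℕ} (b : Fin k → ℝ) :
    HasIntegralValue (expPi k) (fun z => (∑ i, b i * z i) ^ 2)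
      (∑ i, b i ^ 2 + (∑ i, b i) ^ 2) := by
  obtain ⟨hi, h1, h2, -⟩ := moments_centered_sum b
  have e1 : HasIntegralValue (expPi k) (fun z => ∑ i, b i * (z i - 1)) 0 := ⟨by simpa using hi 1, h1⟩
  have e2 : HasIntegralValue (expPi k) (fun z => (∑ i, b i * (z i - 1)) ^ 2) _ := ⟨hi 2, h2⟩
  have e0 : HasIntegralValue (expPi k) (fun _ => (∑ i, b i) ^ 2) ((∑ i, b i) ^ 2) := by
    refine ⟨integrable_const _, by simp⟩
  exact ((e2.add (e1.const_mul (2 * ∑ i, b i))).add e0).congr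
    (fun z => by rw [sum_eq_centered_add]; ring) (by ring)

theorem integrable_sum_fourth {k : ℕ} (b : Fin k → ℝ) :
    Integrable (fun z => (∑ i, b i * z i) ^ 4) (expPi k) :=
  MemLp.integrable_pow_of_ne_zero four_ne_zero (memLp_sum_expPi b four_ne_zero)

theorem integral_sum_fourth_le {k : ℕ} (b : Fin k → ℝ) :
    ∫ z, (∑ i, b i * z i) ^ 4 ∂expPi k ≤ 18 * (∑ i, b i ^ 2 + (∑ i, b i) ^ 2) ^ 2 := by
  obtain ⟨hi, h1, h2, h4⟩ := moments_centered_sum b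
  set D := ∑ i, b i with hD
  set β := ∑ i, b i ^ 2 with hβ
  have hβ0 : 0 ≤ β := Finset.sum_nonneg fun i _ => sq_nonneg _
  have e1 : HasIntegralValue (expPi k) (fun z => ∑ i, b i * (z i - 1)) 0 := ⟨by simpa using hi 1, h1⟩
  have e2 : HasIntegralValue (expPi k) (fun z => (∑ i, b i * (z i - 1)) ^ 2) _ := ⟨hi 2, h2⟩
  have e4 : HasIntegralValue (expPi k) (fun z => (∑ i, b i * (z i - 1)) ^ 4) _ := ⟨hi 4, rfl⟩
  have e0 : HasIntegralValue (expPi k) (fun _ => D ^ 4) (D ^ 4) :=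
    ⟨integrable_const _, by simp⟩
  have e := (((e4.const_mul 2).add (e2.const_mul (10 * D ^ 2))).add
    (e1.const_mul (4 * D ^ 3))).add e0
  have hle : ∫ z, (∑ i, b i * z i) ^ 4 ∂expPi k ≤ _ :=
    integral_mono (integrable_sum_fourth b) e.1 fun z => by
      simp only [sum_eq_centered_add b z, ← hD]
      set Z := ∑ i, b i * (z i - 1)
      nlinarith [sq_nonneg (Z * (Z - 2 * D))]
  rw [e.2] at hle
  nlinarith [mul_nonneg hβ0 (sq_nonneg D), sq_nonneg (D ^ 2)]

theorem le_integral_abs_sum {k : ℕ} (b : Fin k → ℝ) {r : ℝ} (hr : 0 < r)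
    (hr2 : r ^ 2 = ∑ i, b i ^ 2 + (∑ i, b i) ^ 2) :
    19 / 81 * r ≤ ∫ z, |∑ i, b i * z i| ∂expPi k := by
  have e2 := hasIntegralValue_sum_sq b
  rw [← hr2] at e2
  have e4 : HasIntegralValue (expPi k) (fun z => (∑ i, b i * z i) ^ 4) _ :=
    ⟨integrable_sum_fourth b, rfl⟩
  have h4 := integral_sum_fourth_le b
  rw [← hr2] at h4
  have e := (e2.const_mul (1 / (3 * r))).sub (e4.const_mul (4 / (729 * r ^ 3)))
  refine le_trans ?_ (integral_mono e.1 (integrable_sum_expPi b).abs fun z => ?_)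
  · rw [e.2]
    have h5 : 4 / (729 * r ^ 3) * ∫ z, (∑ i, b i * z i) ^ 4 ∂expPi k
        ≤ 4 / (729 * r ^ 3) * (18 * (r ^ 2) ^ 2) := by gcongr
    have h6 : 4 / (729 * r ^ 3) * (18 * (r ^ 2) ^ 2) = 8 / 81 * r := by field_simp; norm_num
    have h7 : 1 / (3 * r) * r ^ 2 = 1 / 3 * r := by field_simp
    linarith
  · simp only
    set x := ∑ i, b i * z i
    obtain ⟨y, hy, hy0⟩ : ∃ y, |x| = r * y ∧ 0 ≤ y :=
      ⟨|x| / r, by field_simp, by positivity⟩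
    have h2 : x ^ 2 = r ^ 2 * y ^ 2 := by rw [← sq_abs, hy]; ring
    have h4 : x ^ 4 = r ^ 4 * y ^ 4 := by
      rw [show x ^ 4 = (x ^ 2) ^ 2 by ring, h2]; ring
    rw [hy, h2, h4]
    have : 1 / (3 * r) * (r ^ 2 * y ^ 2) - 4 / (729 * r ^ 3) * (r ^ 4 * y ^ 4)
        = r * (y - 4 / 729 * y * (y - 9 / 2) ^ 2 * (y + 9)) := by
      field_simp; ring
    rw [this]
    refine mul_le_mul_of_nonneg_left ?_ hr.le
    have : 0 ≤ 4 / 729 * y * (y - 9 / 2) ^ 2 * (y + 9) := by positivity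
    linarith

theorem exp_neg_le_quadratic {q : ℝ} (hq : 0 ≤ q) : exp (-q) ≤ 1 - q + q ^ 2 / 2 := by
  have h := Real.quadratic_le_exp_of_nonneg hq
  rw [exp_neg, inv_le_comm₀ (exp_pos q) (by nlinarith [sq_nonneg (q - 1)])]
  refine le_trans ?_ h
  rw [inv_le_iff_one_le_mul₀ (by nlinarith [sq_nonneg (q - 1)])]
  nlinarith [sq_nonneg (q ^ 2)]

theorem mixConv_laplaceDensity_zero_le {k : ℕ} (b : Fin k → ℝ) {u v w r : ℝ} (hu : 0 < u)
    (hv : 0 < v) (huw : u ≤ w) (hvw : v ≤ w) (hr : 0 < r)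
    (hr2 : r ^ 2 = ∑ i, b i ^ 2 + (∑ i, b i) ^ 2) :
    mixConv b (laplaceDensity u v) 0
      ≤ (u + v)⁻¹ * (1 - 19 / 81 * r / w + r ^ 2 / (2 * w ^ 2)) := by
  have hw : 0 < w := by linarith
  have e2 := hasIntegralValue_sum_sq b
  rw [← hr2] at e2
  have e1 : HasIntegralValue (expPi k) (fun z => |∑ i, b i * z i|) _ :=
    ⟨(integrable_sum_expPi b).abs, rfl⟩
  have e0 : HasIntegralValue (expPi k) (fun _ => (1 : ℝ)) 1 := ⟨integrable_const _, by simp⟩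
  have e := (((e0.sub (e1.const_mul w⁻¹)).add (e2.const_mul (1 / (2 * w ^ 2)))).const_mul
    (u + v)⁻¹)
  refine le_trans (integral_mono ((isGoodPF2_laplaceDensity hu hv).integrable_comp
    (by fun_prop)) e.1 fun z => ?_) ?_
  · simp only [laplaceDensity, zero_sub]
    set x := ∑ i, b i * z i
    refine mul_le_mul_of_nonneg_left ?_ (by positivity)
    have h1 : min (-(-x / u)) (-x / v) ≤ -(|x| / w) := by
      rcases le_total 0 x with hx | hx
      · refine (min_le_right _ _).trans ?_
        rw [abs_of_nonneg hx, neg_div]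
        gcongr
      · refine (min_le_left _ _).trans ?_
        rw [abs_of_nonpos hx]
        have : 0 ≤ -x := by linarith
        gcongr
    refine (exp_le_exp.2 h1).trans ((exp_neg_le_quadratic (by positivity)).trans_eq ?_)
    rw [div_pow, sq_abs]
    ring
  · rw [e.2]
    refine mul_le_mul_of_nonneg_left ?_ (by positivity)
    have := mul_le_mul_of_nonneg_left (le_integral_abs_sum b hr hr2) (inv_pos.2 hw).le
    have h2 : 19 / 81 * r / w = w⁻¹ * (19 / 81 * r) := by ring
    have h3 : r ^ 2 / (2 * w ^ 2) = 1 / (2 * w ^ 2) * r ^ 2 := by ring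
    linarith

lemma sq_norm_sub_smul_single_sub_single {n : ℕ} (hn : 1 ≤ n)
    (a : EuclideanSpace ℝ (Fin (n + 1))) (ha : ‖a‖ = 1) :
    ‖a - (√2)⁻¹ • (EuclideanSpace.single (0 : Fin (n + 1)) (1 : ℝ)
      - EuclideanSpace.single (Fin.last n) (1 : ℝ))‖ ^ 2 = 2 - √2 * (a 0 - a (Fin.last n)) := by
  have hne : (0 : Fin (n + 1)) ≠ Fin.last n := by
    intro h
    have := congrArg Fin.val h
    simp at this
    omega
  have h2 : √2 ^ 2 = 2 := sq_sqrt (by norm_num)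
  have h0 : √2 ≠ 0 := by positivity
  have e1 : ‖EuclideanSpace.single (0 : Fin (n + 1)) (1 : ℝ)
      - EuclideanSpace.single (Fin.last n) (1 : ℝ)‖ ^ 2 = 2 := by
    rw [norm_sub_sq_real, EuclideanSpace.inner_single_left]
    simp [hne]
    norm_num
  rw [norm_sub_sq_real, ha, norm_smul, mul_pow, e1, inner_smul_right, inner_sub_right,
    EuclideanSpace.inner_single_right, EuclideanSpace.inner_single_right]
  simp only [norm_inv, Real.norm_eq_abs, abs_of_pos (show (0 : ℝ) < √2 by positivity), inv_pow, h2,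
    conj_trivial, one_mul]
  field_simp
  linear_combination (a 0 - a (Fin.last n)) * h2

lemma local_bound {u v r δ : ℝ} (hu : 0 < u) (hv : 0 < v) (hδ : δ = 2 - √2 * (u + v))
    (hδ0 : 0 < δ) (hδ1 : δ ≤ 1 / 500) (huv : u ^ 2 + v ^ 2 ≤ 1) (hr : 0 < r)
    (hr2 : r ^ 2 = 1 - u ^ 2 - v ^ 2 + (u - v) ^ 2) :
    u ≤ 37 / 50 ∧ v ≤ 37 / 50 ∧
    (u + v)⁻¹ * (1 - 19 / 81 * r / (37 / 50) + r ^ 2 / (2 * (37 / 50) ^ 2)) ≤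
      (√2)⁻¹ - 1 / 10 * √δ := by
  set t := √2 with ht
  have ht2 : t ^ 2 = 2 := sq_sqrt (by norm_num)
  have ht0 : 0 < t := by positivity
  have ht1 : t < 1.4143 := by nlinarith
  have ht1' : 1.414 < t := by nlinarith
  set q := √δ with hq
  have hq2 : q ^ 2 = δ := sq_sqrt hδ0.le
  have hq0 : 0 < q := sqrt_pos.2 hδ0
  have hq1 : q ≤ 0.0448 := by nlinarith
  have hs : u + v = t * (1 - q ^ 2 / 2) := by
    rw [hq2, hδ]; linear_combination (-(u + v) / 2) * ht2
  have hs2 : (u + v) ^ 2 = 2 * (1 - q ^ 2 / 2) ^ 2 := by rw [hs, mul_pow, ht2]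
  have hD : (u - v) ^ 2 ≤ 2 * q ^ 2 := by nlinarith [sq_nonneg (q ^ 2)]
  have hr3 : r ^ 2 = q ^ 2 - q ^ 4 / 4 + (u - v) ^ 2 / 2 := by
    rw [hr2]; linear_combination (-1 / 2) * hs2
  have hr4 : 0.99 * q ≤ r := by
    refine (sq_le_sq₀ (by positivity) hr.le).1 ?_
    have h4 : q ^ 2 * q ^ 2 ≤ 0.003 * q ^ 2 := by gcongr; linarith
    nlinarith [sq_nonneg (u - v)]
  have hr5 : r ^ 2 ≤ 2 * q ^ 2 := by nlinarith [sq_nonneg (q ^ 2)]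
  have hDa : |u - v| ≤ 0.0634 := abs_le_of_sq_le_sq (by nlinarith) (by norm_num)
  have hD1 := abs_le.1 hDa
  have hs' : u + v ≤ 1.4143 := by
    rw [hs]
    linarith [mul_pos ht0 (pow_pos hq0 2)]
  refine ⟨by linarith [hD1.2], by linarith [hD1.1], ?_⟩
  rw [inv_mul_le_iff₀ (by positivity), hs]
  have e : t * (1 - q ^ 2 / 2) * (t⁻¹ - 1 / 10 * q) = (1 - q ^ 2 / 2) * (1 - t * q / 10) := by
    field_simp
  rw [e]
  have h1 : (1 - q ^ 2 / 2) * (1 - t * q / 10) ≥ 1 - q ^ 2 / 2 - t * q / 10 := by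
    have : 0 ≤ t * q ^ 3 := by positivity
    nlinarith
  have h2 : t * q ≤ 1.4143 * q := by gcongr
  have h3 : q ^ 2 ≤ 0.0448 * q := by rw [pow_two]; gcongr
  norm_num at hr4 h1 h2 h3 ⊢
  linarith

lemma pos_zero_of_antitone {n : ℕ} (a : Fin (n + 1) → ℝ) (hsum : ∑ j, a j = 0)
    (hne : ∑ j, a j ^ 2 = 1) (hmono : ∀ i j : Fin (n + 1), i ≤ j → a j ≤ a i) : 0 < a 0 := by
  by_contra! h
  have h1 : ∀ j, a j ≤ 0 := fun j => (hmono 0 j (Fin.zero_le j)).trans h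
  have h2 : ∀ j, a j = 0 := fun j =>
    (Finset.sum_eq_zero_iff_of_nonpos fun i _ => h1 i).1 hsum j (Finset.mem_univ j)
  simp [h2] at hne

lemma last_neg_of_antitone {n : ℕ} (a : Fin (n + 1) → ℝ) (hsum : ∑ j, a j = 0)
    (hne : ∑ j, a j ^ 2 = 1) (hmono : ∀ i j : Fin (n + 1), i ≤ j → a j ≤ a i) :
    a (Fin.last n) < 0 := by
  by_contra! h
  have h1 : ∀ j, 0 ≤ a j := fun j => h.trans (hmono j _ (Fin.le_last j))
  have h2 : ∀ j, a j = 0 := fun j =>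
    (Finset.sum_eq_zero_iff_of_nonneg fun i _ => h1 i).1 hsum j (Finset.mem_univ j)
  simp [h2] at hne

/-- The stability estimate near the extremal direction. -/
lemma apply_zero_le_of_le {m : ℕ} (a : Fin (m + 2) → ℝ) (hsum : ∑ j, a j = 0)
    (hsq : ∑ j, a j ^ 2 = 1) (hu : 0 < a 0) (hv : a (Fin.last (m + 1)) < 0)
    {δ : ℝ} (hδ : δ = 2 - √2 * (a 0 - a (Fin.last (m + 1)))) (hδ0 : 0 ≤ δ)
    (hδ1 : δ ≤ 1 / 500) :
    mixConv (fun i : Fin m => a i.castSucc.succ) (laplaceDensity (a 0) (-a (Fin.last (m + 1)))) 0 ≤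
      (√2)⁻¹ - 1 / 10 * √δ := by
  rcases hδ0.eq_or_lt with rfl | hpos
  · have h := (hasSumDensity_mixConv a hu hv).good.le 0
    refine h.trans_eq ?_
    have : a 0 + -a (Fin.last (m + 1)) = √2 := by
      have h2 : √2 ^ 2 = 2 := sq_sqrt (by norm_num)
      have h0 : √2 ≠ 0 := by positivity
      apply mul_left_cancel₀ h0
      linarith
    rw [this]
    simp
  · set b : Fin m → ℝ := fun i => a i.castSucc.succ with hb
    rw [Fin.sum_univ_succ, Fin.sum_univ_castSucc] at hsum hsq
    simp only [Fin.succ_last, Nat.succ_eq_add_one] at hsum hsq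
    set u := a 0
    set v := -a (Fin.last (m + 1)) with hvd
    have hv0 : 0 < v := by linarith
    have hβ : ∑ i, b i ^ 2 = 1 - u ^ 2 - v ^ 2 := by
      simp only [hb, hvd]; linarith
    have hD : ∑ i, b i = v - u := by
      simp only [hb, hvd]; linarith
    have hβ0 : 0 ≤ ∑ i, b i ^ 2 := Finset.sum_nonneg fun i _ => sq_nonneg _
    have hδ' : δ = 2 - √2 * (u + v) := by rw [hδ, hvd]; ring
    have ht2 : √2 ^ 2 = 2 := sq_sqrt (by norm_num)
    have hr : 0 < ∑ i, b i ^ 2 + (∑ i, b i) ^ 2 := by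
      have h1 : (u + v) ^ 2 = 2 * (1 - δ / 2) ^ 2 := by
        have : u + v = √2 * (1 - δ / 2) := by
          rw [hδ']; linear_combination (-(u + v) / 2) * ht2
        rw [this, mul_pow, ht2]
      rw [hβ, hD]
      nlinarith [sq_nonneg (u - v)]
    have hr2 : √(∑ i, b i ^ 2 + (∑ i, b i) ^ 2) ^ 2 = ∑ i, b i ^ 2 + (∑ i, b i) ^ 2 :=
      sq_sqrt hr.le
    obtain ⟨h1, h2, h3⟩ := local_bound hu hv0 hδ' hpos hδ1 (by linarith) (sqrt_pos.2 hr)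
      (by rw [hr2, hβ, hD]; ring)
    exact (mixConv_laplaceDensity_zero_le b hu hv0 h1 h2 (sqrt_pos.2 hr) hr2).trans h3

end Auxiliary

/-- **Theorem (dimension-free stability of Webb's sharp simplex slicing).**
Let `a = (a₁, ..., a_{n+1})` be a unit vector in `ℝ^{n+1}` with `∑ aⱼ = 0` and
`a₁ ≥ a₂ ≥ ... ≥ a_{n+1}`. Set `δ(a) = |a - (e₁ - e_{n+1})/√2|²`. Then
`p_a(0) ≤ 1/√2 - (1/10)√δ(a)` if `δ(a) ≤ 1/2000`, and
`p_a(0) ≤ 1/√2 - 2√2 ⬝ 10⁻⁵` if `δ(a) > 1/2000`. -/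
theorem simplex_slicing_stability (n : ℕ) (hn : 1 ≤ n)
    (a : EuclideanSpace ℝ (Fin (n + 1))) (hnorm : ‖a‖ = 1)
    (hsum : ∑ j, a j = 0) (hmono : ∀ i j : Fin (n + 1), i ≤ j → a j ≤ a i)
    (p : ℝ → ℝ) (hp : IsExpSumDensity (fun j => a j) p)
    (δ : ℝ)
    (hδ : δ = ‖a - (Real.sqrt 2)⁻¹ •
        (EuclideanSpace.single (0 : Fin (n + 1)) (1 : ℝ)
          - EuclideanSpace.single (Fin.last n) (1 : ℝ))‖ ^ 2) :
    (δ ≤ 1 / 2000 → p 0 ≤ (Real.sqrt 2)⁻¹ - (1 / 10) * Real.sqrt δ) ∧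
      (δ > 1 / 2000 → p 0 ≤ (Real.sqrt 2)⁻¹ - 2 * Real.sqrt 2 / 100000) := by
  obtain ⟨m, rfl⟩ : ∃ m, n = m + 1 := ⟨n - 1, by omega⟩
  have hsq : ∑ j, a j ^ 2 = 1 := by
    rw [← EuclideanSpace.real_norm_sq_eq, hnorm, one_pow]
  have hu := pos_zero_of_antitone (fun j => a j) hsum hsq hmono
  have hv := last_neg_of_antitone (fun j => a j) hsum hsq hmono
  have hδ' : δ = 2 - √2 * (a 0 - a (Fin.last (m + 1))) :=
    hδ.trans (sq_norm_sub_smul_single_sub_single hn a hnorm)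
  have hδ0 : 0 ≤ δ := hδ ▸ sq_nonneg _
  have hf := hasSumDensity_mixConv (fun j => a j) hu hv
  have hloc := apply_zero_le_of_le (fun j => a j) hsum hsq hu hv hδ' hδ0
  have hpf := hf.apply_le_of_isExpSumDensity hp 0
  refine ⟨fun h => hpf.trans (hloc (by linarith)), fun h => hpf.trans ?_⟩
  by_contra! hc
  have ht2 : √2 ^ 2 = 2 := sq_sqrt (by norm_num)
  have ht0 : 0 < √2 := by positivity
  have ht1 : √2 < 1.414214 := by nlinarith
  have ht1' : 1.414213 < √2 := by nlinarith
  have hti : (√2)⁻¹ = √2 / 2 := by field_simp; rw [ht2]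
  rw [hti] at hc hloc
  have hs := hf.le_add_of_le_apply_zero hsum hsq hu (neg_pos.2 hv)
    (fun j => hmono 0 j (Fin.zero_le j))
    (fun j => by simpa using hmono j _ (Fin.le_last j)) (by linarith)
  have hδ1 : δ ≤ 1 / 500 := by
    rw [hδ']
    dsimp only at hs
    nlinarith
  have hq : 0.02 ≤ √δ := Real.le_sqrt_of_sq_le (by linarith)
  linarith [hloc hδ1]
end

section
/- Let n ≥ 1 and let a = (a_1, ..., a_{n+1}) be a unit vector in ℝ^{n+1} with a_1 + ... + a_{n+1} = 0 and a_1 ≥ a_2 ≥ ... ≥ a_{n+1}. Set δ(a) = |a − (e_1 − e_{n+1})/√2|². Then p_a(0) ≤ 1/√2 − 2·10⁻⁵·√δ(a). -/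
open MeasureTheory ProbabilityTheory Real

namespace SimplexSlicing

open Set Filter Topology ENNReal FourierTransform

instance : IsProbabilityMeasure (expMeasure 1) := isProbabilityMeasure_expMeasure one_pos

lemma expMeasure_one_eq :
    expMeasure 1 = (volume.restrict (Ioi (0 : ℝ))).withDensity
      fun x => ENNReal.ofReal (exp (-x)) := by
  have h : expMeasure 1 = volume.withDensity (exponentialPDF 1) := rfl
  rw [h, ← withDensity_indicator measurableSet_Ioi]
  apply withDensity_congr_ae
  have h0 : ∀ᵐ x : ℝ, x ≠ 0 := by simp [ae_iff]
  filter_upwards [h0] with x hx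
  by_cases hp : 0 < x
  · simp [exponentialPDF_of_nonneg hp.le, hp]
  · simp [exponentialPDF_of_neg (lt_of_le_of_ne (not_lt.1 hp) hx), hp]

lemma lintegral_expMeasure {f : ℝ → ℝ≥0∞} (hf : Measurable f) :
    ∫⁻ x, f x ∂(expMeasure 1) = ∫⁻ x in Ioi (0 : ℝ), ENNReal.ofReal (exp (-x)) * f x := by
  rw [expMeasure_one_eq, lintegral_withDensity_eq_lintegral_mul _ (by fun_prop) hf]
  rfl

lemma integral_expMeasure {E : Type*} [NormedAddCommGroup E] [NormedSpace ℝ E] (f : ℝ → E) :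
    ∫ x, f x ∂(expMeasure 1) = ∫ x in Ioi (0 : ℝ), exp (-x) • f x := by
  rw [expMeasure_one_eq, integral_withDensity_eq_integral_toReal_smul (by fun_prop) (by simp)]
  simp [ENNReal.toReal_ofReal (exp_pos _).le]

lemma integrable_expMeasure {f : ℝ → ℝ} :
    Integrable f (expMeasure 1) ↔ IntegrableOn (fun x => exp (-x) * f x) (Ioi (0 : ℝ)) := by
  rw [expMeasure_one_eq, integrable_withDensity_iff_integrable_smul' (by fun_prop) (by simp)]
  simp [ENNReal.toReal_ofReal (exp_pos _).le, IntegrableOn]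

lemma integrable_pow_expMeasure (k : ℕ) : Integrable (fun x : ℝ => x ^ k) (expMeasure 1) := by
  rw [integrable_expMeasure]
  have := Real.GammaIntegral_convergent (s := k + 1) (by positivity)
  refine this.congr_fun (fun x hx => ?_) measurableSet_Ioi
  simp [← Real.rpow_natCast]

lemma integral_pow_expMeasure (k : ℕ) : ∫ x : ℝ, x ^ k ∂(expMeasure 1) = k.factorial := by
  rw [integral_expMeasure, ← Real.Gamma_nat_eq_factorial, Real.Gamma_eq_integral (by positivity)]
  refine setIntegral_congr_fun measurableSet_Ioi (fun x hx => ?_)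
  simp [← Real.rpow_natCast]

lemma lintegral_pi_succAbove {n : ℕ} (i : Fin (n + 1)) {f : (Fin (n + 1) → ℝ) → ℝ≥0∞}
    (hf : Measurable f) :
    ∫⁻ x, f x ∂(Measure.pi fun _ => expMeasure 1)
      = ∫⁻ y : Fin n → ℝ, ∫⁻ u, f (i.insertNth u y) ∂(expMeasure 1)
          ∂(Measure.pi fun _ => expMeasure 1) := by
  have h := (measurePreserving_piFinSuccAbove
    (fun _ : Fin (n + 1) => expMeasure 1) i).symm
  rw [← h.lintegral_comp hf, lintegral_prod_symm]
  · rfl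
  · exact (hf.comp h.measurable).aemeasurable

/-- The density of `a X` at `t`, for `X` standard exponential and `a > 0`. -/
noncomputable def expDensity (a t : ℝ) : ℝ≥0∞ :=
  (Ioi (0 : ℝ)).indicator (fun t => ENNReal.ofReal (a⁻¹ * exp (-(t / a)))) t

@[fun_prop]
lemma measurable_expDensity (a : ℝ) : Measurable (expDensity a) :=
  Measurable.indicator (by fun_prop) measurableSet_Ioi

lemma lintegral_expMeasure_add {a : ℝ} (ha : 0 < a) (v : ℝ) {f : ℝ → ℝ≥0∞} (hf : Measurable f) :
    ∫⁻ u, f (a * u + v) ∂(expMeasure 1) = ∫⁻ z, expDensity a (z - v) * f z := by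
  rw [lintegral_expMeasure (by fun_prop), ← lintegral_indicator measurableSet_Ioi]
  have h : ∀ u : ℝ, (Ioi (0 : ℝ)).indicator (fun x => ENNReal.ofReal (exp (-x)) * f (a * x + v)) u
      = ENNReal.ofReal a * (expDensity a (a * u) * f (a * u + v)) := by
    intro u
    by_cases hu : 0 < u
    · have hau : 0 < a * u := by positivity
      have : a * u / a = u := by field_simp
      rw [expDensity, indicator_of_mem (mem_Ioi.2 hu), indicator_of_mem (mem_Ioi.2 hau),
        ← mul_assoc,
        ← ENNReal.ofReal_mul ha.le, this, mul_inv_cancel_left₀ ha.ne']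
    · have hau : ¬ 0 < a * u := fun h => hu (pos_of_mul_pos_right h ha.le)
      rw [expDensity, indicator_of_notMem (by simpa using hu),
        indicator_of_notMem (by simpa using hau)]
      simp
  simp_rw [h]
  have hm : Measurable fun z => expDensity a (z - v) * f z :=
    ((measurable_expDensity a).comp (by fun_prop)).mul hf
  have hm' : Measurable fun z => expDensity a z * f (z + v) :=
    (measurable_expDensity a).mul (by fun_prop)
  rw [lintegral_const_mul _ (by fun_prop),
    ← lintegral_add_right_eq_self (fun z => expDensity a (z - v) * f z) v]
  simp only [add_sub_cancel_right]
  have hmap := Real.map_volume_mul_left ha.ne'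
  have h2 : ∫⁻ z, expDensity a z * f (z + v) ∂(Measure.map (a * ·) volume)
      = ∫⁻ u, expDensity a (a * u) * f (a * u + v) :=
    lintegral_map hm' (by fun_prop)
  rw [← h2, hmap, lintegral_smul_measure, smul_eq_mul, ← mul_assoc, ← ENNReal.ofReal_mul ha.le,
    abs_of_pos (inv_pos.2 ha), mul_inv_cancel₀ ha.ne']
  simp

lemma le_of_withDensity_le {p F : ℝ → ℝ} (hp : Continuous p) (hF : Continuous F)
    (hF0 : ∀ z, 0 ≤ F z)
    (h : ∀ A, MeasurableSet A →
      (volume.withDensity fun x => ENNReal.ofReal (p x)) A ≤ ∫⁻ z in A, ENNReal.ofReal (F z))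
    (z : ℝ) : p z ≤ F z := by
  have hae : (fun x => ENNReal.ofReal (p x)) ≤ᵐ[volume] fun x => ENNReal.ofReal (F x) := by
    refine ae_le_of_forall_setLIntegral_le_of_sigmaFinite (by fun_prop) fun s hs _ => ?_
    rw [← withDensity_apply _ hs]
    exact h s hs
  have hopen : IsOpen {x | F x < p x} := isOpen_lt hF hp
  have hnull : volume {x | F x < p x} = 0 := by
    refine measure_mono_null ?_ hae
    intro x hx hle
    exact absurd ((ENNReal.ofReal_le_ofReal_iff (hF0 x)).1 hle) (not_le.2 hx)
  have := (hopen.measure_eq_zero_iff (μ := volume)).1 hnull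
  by_contra hz
  exact (this ▸ (not_le.1 hz : z ∈ {x | F x < p x}) : z ∈ (∅ : Set ℝ))

lemma le_of_lintegral_expDensity_le {n : ℕ} {a : Fin (n + 1) → ℝ} {p : ℝ → ℝ}
    (hp : IsExpSumDensity a p) (i : Fin (n + 1)) (hi : 0 < a i) {F : ℝ → ℝ} (hF : Continuous F)
    (hF0 : ∀ z, 0 ≤ F z)
    (h : ∀ z, ∫⁻ y : Fin n → ℝ, expDensity (a i) (z - ∑ j, a (i.succAbove j) * y j)
      ∂(Measure.pi fun _ => expMeasure 1) ≤ ENNReal.ofReal (F z)) (z : ℝ) : p z ≤ F z := by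
  refine le_of_withDensity_le hp.1 hF hF0 (fun A hA => ?_) z
  have hZ : Measurable fun x : Fin (n + 1) → ℝ => ∑ j, a j * x j := by fun_prop
  have hI : Measurable (A.indicator (1 : ℝ → ℝ≥0∞)) := measurable_one.indicator hA
  have hD := measurable_expDensity (a i)
  rw [← hp.2, ← lintegral_indicator_one hA, lintegral_map hI hZ,
    lintegral_pi_succAbove i (f := fun x => A.indicator 1 (∑ j, a j * x j)) (hI.comp hZ)]
  have h1 : ∀ y : Fin n → ℝ, ∫⁻ u, A.indicator (1 : ℝ → ℝ≥0∞)
      (∑ j, a j * i.insertNth (α := fun _ => ℝ) u y j) ∂(expMeasure 1)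
      = ∫⁻ z in A, expDensity (a i) (z - ∑ j, a (i.succAbove j) * y j) := by
    intro y
    simp only [Fin.sum_univ_succAbove _ i, Fin.insertNth_apply_same, Fin.insertNth_apply_succAbove]
    rw [lintegral_expMeasure_add hi _ hI, ← lintegral_indicator hA]
    congr 1
    ext z
    by_cases hz : z ∈ A <;> simp [hz]
  simp_rw [h1]
  rw [lintegral_lintegral_swap]
  · exact lintegral_mono h
  · exact (hD.comp (by fun_prop)).aemeasurable

lemma integrable_add_pow_expMeasure (c : ℝ) (k : ℕ) :
    Integrable (fun x : ℝ => (x + c) ^ k) (expMeasure 1) := by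
  simp_rw [add_pow]
  exact integrable_finsetSum _ fun i _ =>
    ((integrable_pow_expMeasure i).mul_const _).mul_const _

lemma integral_centered_expMeasure :
    ∫ x : ℝ, (x + -1) ∂(expMeasure 1) = 0 ∧ ∫ x : ℝ, (x + -1) ^ 2 ∂(expMeasure 1) = 1 ∧
      ∫ x : ℝ, (x + -1) ^ 4 ∂(expMeasure 1) = 9 := by
  have key : ∀ k : ℕ, ∫ x : ℝ, (x + -1) ^ k ∂(expMeasure 1)
      = ∑ i ∈ Finset.range (k + 1), (i.factorial : ℝ) * (-1) ^ (k - i) * (k.choose i : ℝ) := by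
    intro k
    simp_rw [add_pow]
    rw [integral_finsetSum _ fun i _ => ((integrable_pow_expMeasure i).mul_const _).mul_const _]
    simp_rw [integral_mul_const, integral_pow_expMeasure]
  refine ⟨?_, ?_, ?_⟩
  · have := key 1
    simpa [Finset.sum_range_succ] using this
  · rw [key 2]; norm_num [Finset.sum_range_succ, Nat.factorial, Nat.choose]
  · rw [key 4]; norm_num [Finset.sum_range_succ, Nat.factorial, Nat.choose]

/-- Moments of centered linear combinations of independent standard exponentials. -/
lemma centered_moments : ∀ (n : ℕ) (a : Fin n → ℝ),
    (∀ k : ℕ, Integrable (fun x : Fin n → ℝ => (∑ j, a j * (x j + -1)) ^ k)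
      (Measure.pi fun _ => expMeasure 1)) ∧
    ∫ x : Fin n → ℝ, ∑ j, a j * (x j + -1) ∂(Measure.pi fun _ => expMeasure 1) = 0 ∧
    ∫ x : Fin n → ℝ, (∑ j, a j * (x j + -1)) ^ 2 ∂(Measure.pi fun _ => expMeasure 1)
      = ∑ j, a j ^ 2 ∧
    ∫ x : Fin n → ℝ, (∑ j, a j * (x j + -1)) ^ 4 ∂(Measure.pi fun _ => expMeasure 1)
      ≤ 9 * (∑ j, a j ^ 2) ^ 2 := by
  intro n
  induction n with
  | zero => intro a; simp
  | succ n ih =>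
    intro a
    obtain ⟨hI, h1, h2, h4⟩ := ih (fun j => a j.succ)
    set S : (Fin n → ℝ) → ℝ := fun y => ∑ j, a j.succ * (y j + -1) with hS
    set P : Measure (Fin n → ℝ) := Measure.pi fun _ => expMeasure 1 with hP
    replace h2 : ∫ y, S y ^ 2 ∂P = ∑ j : Fin n, a j.succ ^ 2 := h2
    replace h4 : ∫ y, S y ^ 4 ∂P ≤ 9 * (∑ j : Fin n, a j.succ ^ 2) ^ 2 := h4
    set b := a 0 with hb
    have hmp := (measurePreserving_piFinSuccAbove (fun _ : Fin (n + 1) => expMeasure 1) 0).symm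
    have hcomp : ∀ z : ℝ × (Fin n → ℝ),
        ∑ j, a j * (((MeasurableEquiv.piFinSuccAbove (fun _ : Fin (n + 1) => ℝ) 0).symm z) j + -1)
        = b * (z.1 + -1) + S z.2 := by
      intro z
      rw [Fin.sum_univ_succ]
      rfl
    have hint : ∀ k : ℕ, ∀ c : ℝ, ∀ l : ℕ, Integrable
        (fun z : ℝ × (Fin n → ℝ) => (c * (z.1 + -1) ^ k) * (S z.2) ^ l) ((expMeasure 1).prod P) :=
      fun k c l => Integrable.mul_prod (ν := P)
          ((integrable_add_pow_expMeasure (-1) k).const_mul c) (hI l)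
    have hval : ∀ k : ℕ, ∀ c : ℝ, ∀ l : ℕ, 
        ∫ z : ℝ × (Fin n → ℝ), (c * (z.1 + -1) ^ k) * (S z.2) ^ l ∂((expMeasure 1).prod P)
        = c * (∫ x, (x + -1) ^ k ∂(expMeasure 1)) * ∫ y, S y ^ l ∂P := by
      intro k c l
      rw [← integral_const_mul c]
      exact integral_prod_mul (μ := expMeasure 1) (ν := P) (fun x : ℝ => c * (x + -1) ^ k)
          (fun y => S y ^ l)
    obtain ⟨e1, e2, e4⟩ := integral_centered_expMeasure
    have hpull : ∀ k : ℕ, ∫ x : Fin (n + 1) → ℝ, (∑ j, a j * (x j + -1)) ^ k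
          ∂(Measure.pi fun _ => expMeasure 1)
        = ∫ z : ℝ × (Fin n → ℝ), (b * (z.1 + -1) + S z.2) ^ k ∂((expMeasure 1).prod P) := by
      intro k
      rw [← hmp.integral_comp']
      simp_rw [hcomp]
      rfl
    refine ⟨?_, ?_, ?_, ?_⟩
    · intro k
      rw [← hmp.integrable_comp_emb (MeasurableEquiv.measurableEmbedding _)]
      have : Integrable (fun z : ℝ × (Fin n → ℝ) => (b * (z.1 + -1) + S z.2) ^ k)
          ((expMeasure 1).prod P) := by
        simp_rw [add_pow (b * _)]
        refine integrable_finsetSum _ fun i _ => Integrable.mul_const ?_ _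
        simp_rw [mul_pow]
        exact hint _ _ _
      refine this.congr (ae_of_all _ fun z => ?_)
      exact congrArg (· ^ k) (hcomp z).symm
    · have := hpull 1
      simp only [pow_one] at this
      rw [this]
      have e : ∀ z : ℝ × (Fin n → ℝ), b * (z.1 + -1) + S z.2
          = (b * (z.1 + -1) ^ 1) * S z.2 ^ 0 + (1 * (z.1 + -1) ^ 0) * S z.2 ^ 1 := by
        intro z; ring
      simp_rw [e]
      rw [integral_add (hint _ _ _) (hint _ _ _), hval, hval]
      simp [e1, h1]
    · rw [hpull 2]
      have e : ∀ z : ℝ × (Fin n → ℝ), (b * (z.1 + -1) + S z.2) ^ 2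
          = (b ^ 2 * (z.1 + -1) ^ 2) * S z.2 ^ 0 + (2 * b * (z.1 + -1) ^ 1) * S z.2 ^ 1
            + (1 * (z.1 + -1) ^ 0) * S z.2 ^ 2 := by
        intro z; ring
      simp_rw [e]
      rw [integral_add ((hint _ _ _).fun_add (hint _ _ _)) (hint _ _ _),
        integral_add (hint _ _ _) (hint _ _ _), hval, hval, hval, Fin.sum_univ_succ]
      simp [e1, e2, h1, h2, hb]
    · rw [hpull 4]
      have e : ∀ z : ℝ × (Fin n → ℝ), (b * (z.1 + -1) + S z.2) ^ 4
          = (b ^ 4 * (z.1 + -1) ^ 4) * S z.2 ^ 0 + (4 * b ^ 3 * (z.1 + -1) ^ 3) * S z.2 ^ 1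
            + (6 * b ^ 2 * (z.1 + -1) ^ 2) * S z.2 ^ 2 + (4 * b * (z.1 + -1) ^ 1) * S z.2 ^ 3
            + (1 * (z.1 + -1) ^ 0) * S z.2 ^ 4 := by
        intro z; ring
      simp_rw [e]
      rw [integral_add ((((hint _ _ _).fun_add (hint _ _ _)).fun_add
          (hint _ _ _)).fun_add (hint _ _ _))
          (hint _ _ _),
        integral_add (((hint _ _ _).fun_add (hint _ _ _)).fun_add (hint _ _ _)) (hint _ _ _),
        integral_add ((hint _ _ _).fun_add (hint _ _ _)) (hint _ _ _),
        integral_add (hint _ _ _) (hint _ _ _), hval, hval, hval, hval, hval, Fin.sum_univ_succ]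
      simp only [pow_one, pow_zero, integral_const, e1, e2, e4, h1, h2, probReal_univ, smul_eq_mul]
      have hσ : 0 ≤ b ^ 2 * ∑ j : Fin n, a j.succ ^ 2 :=
        mul_nonneg (sq_nonneg _) (Finset.sum_nonneg fun _ _ => sq_nonneg _)
      simp only [← hb, mul_zero, zero_mul, mul_one, one_mul, add_zero]
      nlinarith [h4]

/-- First, second and fourth moments of `∑ aⱼ Xⱼ`, for `Xⱼ` independent standard exponentials. -/
lemma linear_moments {n : ℕ} (a : Fin n → ℝ) :
    (∀ k : ℕ, Integrable (fun x : Fin n → ℝ => (∑ j, a j * x j) ^ k)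
      (Measure.pi fun _ => expMeasure 1)) ∧
    ∫ x : Fin n → ℝ, ∑ j, a j * x j ∂(Measure.pi fun _ => expMeasure 1) = ∑ j, a j ∧
    ∫ x : Fin n → ℝ, (∑ j, a j * x j) ^ 2 ∂(Measure.pi fun _ => expMeasure 1)
      = ∑ j, a j ^ 2 + (∑ j, a j) ^ 2 ∧
    ∫ x : Fin n → ℝ, (∑ j, a j * x j) ^ 4 ∂(Measure.pi fun _ => expMeasure 1)
      ≤ 49 / 4 * (∑ j, a j ^ 2 + (∑ j, a j) ^ 2) ^ 2 := by
  obtain ⟨hI, h1, h2, h4⟩ := centered_moments n a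
  set P : Measure (Fin n → ℝ) := Measure.pi fun _ => expMeasure 1 with hP
  set S : (Fin n → ℝ) → ℝ := fun y => ∑ j, a j * (y j + -1) with hS
  replace hI : ∀ k : ℕ, Integrable (fun y => S y ^ k) P := hI
  set μ := ∑ j, a j with hμ
  set r := ∑ j, a j ^ 2 with hr
  have hr0 : 0 ≤ r := Finset.sum_nonneg fun _ _ => sq_nonneg _
  have hSx : ∀ x : Fin n → ℝ, ∑ j, a j * x j = S x + μ := by
    intro x
    simp only [hS, hμ, ← Finset.sum_add_distrib]
    exact Finset.sum_congr rfl fun j _ => by ring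
  simp_rw [hSx]
  have hI' : ∀ k : ℕ, Integrable (fun x => (S x + μ) ^ k) P := by
    intro k
    simp_rw [add_pow]
    exact integrable_finsetSum _ fun i _ => ((hI i).mul_const _).mul_const _
  have hI1 : Integrable S P := by simpa using hI 1
  refine ⟨hI', ?_, ?_, ?_⟩
  · rw [integral_add hI1 (integrable_const _), h1]; simp
  · have e : ∀ x, (S x + μ) ^ 2 = S x ^ 2 + 2 * μ * S x + μ ^ 2 := fun x => by ring
    simp_rw [e]
    rw [integral_add ((hI 2).fun_add (hI1.const_mul _)) (integrable_const _),
      integral_add (hI 2) (hI1.const_mul _), integral_const_mul, h1, h2]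
    simp
  · have hle : ∫ x, (S x + μ) ^ 4 ∂P ≤ ∫ x, (5 / 4 * S x ^ 4 + 22 * μ ^ 2 * S x ^ 2 + μ ^ 4
        + 4 * μ ^ 3 * S x) ∂P := by
      refine integral_mono (hI' 4) ((((hI 4).const_mul _).fun_add ((hI 2).const_mul _)).add
        (integrable_const _) |>.fun_add (hI1.const_mul _)) fun x => ?_
      show (S x + μ) ^ 4 ≤ 5 / 4 * S x ^ 4 + 22 * μ ^ 2 * S x ^ 2 + μ ^ 4 + 4 * μ ^ 3 * S x
      nlinarith [sq_nonneg (S x * (S x - 8 * μ))]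
    rw [integral_add (((hI 4).const_mul _).fun_add ((hI 2).const_mul _) |>.fun_add
        (integrable_const _))
      (hI1.const_mul _), integral_add (((hI 4).const_mul _).fun_add ((hI 2).const_mul _))
      (integrable_const _), integral_add ((hI 4).const_mul _) ((hI 2).const_mul _),
      integral_const_mul, integral_const_mul, integral_const_mul, h1, h2] at hle
    simp only [integral_const, probReal_univ, smul_eq_mul] at hle
    have := mul_nonneg hr0 (sq_nonneg μ)
    nlinarith [sq_nonneg r, sq_nonneg (μ ^ 2)]

lemma exp_neg_le_quadratic {b : ℝ} (hb : 0 ≤ b) :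
    exp (-b) ≤ 1 - 77 / 100 * b + 174 / 1000 * b ^ 2 := by
  have h := Real.sum_le_exp_of_nonneg hb 6
  norm_num [Finset.sum_range_succ, Nat.factorial] at h
  have hq : 0 < 1 - 77 / 100 * b + 174 / 1000 * b ^ 2 := by nlinarith [sq_nonneg (b - 2)]
  rw [exp_neg, inv_le_iff_one_le_mul₀ (exp_pos b)]
  refine le_trans ?_ (mul_le_mul_of_nonneg_left h hq.le)
  have h0 : 0 ≤ 23 / 100 + (-12 / 125) * b + (-133 / 3000) * b ^ 2
    + (1 / 3000) * b ^ 3 + (21 / 4000) * b ^ 4 + (1 / 1200) * b ^ 5 + (29 / 20000) * b ^ 6 := by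
    have h4 : 0 ≤ (b ^ 2 - 14 / 5) ^ 2 := sq_nonneg _
    have h6 : 0 ≤ (b ^ 2 - 14 / 5) ^ 2 * (b ^ 2 + 28 / 5) := by positivity
    have h3 : 0 ≤ b ^ 3 := by positivity
    have h5 : 0 ≤ b ^ 5 := by positivity
    nlinarith [sq_nonneg (b - 13 / 5)]
  nlinarith [mul_nonneg hb h0]

lemma exp_neg_le_one_sub_add {u : ℝ} (hu : 0 ≤ u) : exp (-u) ≤ 1 - u + u ^ 2 / 2 := by
  have h := Real.quadratic_le_exp_of_nonneg hu
  have hq : 0 < 1 - u + u ^ 2 / 2 := by nlinarith [sq_nonneg (u - 1)]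
  rw [exp_neg, inv_le_iff_one_le_mul₀ (exp_pos u)]
  refine le_trans ?_ (mul_le_mul_of_nonneg_left h hq.le)
  nlinarith [sq_nonneg (u ^ 2)]

lemma le_of_one_coordinate {n : ℕ} {a : Fin (n + 1) → ℝ} {p : ℝ → ℝ}
    (hp : IsExpSumDensity a p) (hsum : ∑ j, a j = 0) (hsq : ∑ j, a j ^ 2 = 1)
    (i : Fin (n + 1)) (hi : 0 < a i) :
    p 0 ≤ (a i)⁻¹ * (23 / 100 + 174 / 1000 * (a i)⁻¹ ^ 2) := by
  set x := a i with hx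
  obtain ⟨hI, h1, h2, -⟩ := linear_moments (fun j => a (i.succAbove j))
  rw [Fin.sum_univ_succAbove _ i] at hsum hsq
  set P : Measure (Fin n → ℝ) := Measure.pi fun _ => expMeasure 1 with hP
  set V : (Fin n → ℝ) → ℝ := fun y => ∑ j, a (i.succAbove j) * y j with hV
  have hI1 : Integrable V P := by simpa using hI 1
  replace hI : ∀ k : ℕ, Integrable (fun y => V y ^ k) P := hI
  replace h1 : ∫ y, V y ∂P = -x := by
    rw [h1]; linarith
  replace h2 : ∫ y, V y ^ 2 ∂P = 1 := by
    rw [h2]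
    have : ∑ j, a (i.succAbove j) = -x := by linarith
    rw [this]; linarith
  set q : ℝ → ℝ := fun b => 1 - 77 / 100 * b + 174 / 1000 * b ^ 2 with hq
  have hq0 : ∀ b, 0 ≤ q b := fun b => by
    simp only [hq]; nlinarith [sq_nonneg (b - 2)]
  set F : ℝ → ℝ := fun z => x⁻¹ * (1 - 77 / 100 * ((z + x) * x⁻¹)
    + 174 / 1000 * ((z ^ 2 + 2 * x * z + 1) * x⁻¹ ^ 2)) with hF
  have e : ∀ z y, x⁻¹ * q ((z - V y) / x) = 174 / 1000 * x⁻¹ ^ 3 * V y ^ 2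
      + (77 / 100 * x⁻¹ ^ 2 - 2 * (174 / 1000) * z * x⁻¹ ^ 3) * V y
      + x⁻¹ * (1 - 77 / 100 * (z * x⁻¹) + 174 / 1000 * (z ^ 2 * x⁻¹ ^ 2)) := by
    intro z y; simp only [hq, div_eq_mul_inv]; ring
  have hint : ∀ z, Integrable (fun y => x⁻¹ * q ((z - V y) / x)) P := by
    intro z
    simp_rw [e]
    exact (((hI 2).const_mul _).add (hI1.const_mul _)).add (integrable_const _)
  have hval : ∀ z, ∫ y, x⁻¹ * q ((z - V y) / x) ∂P = F z := by
    intro z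
    simp_rw [e]
    rw [integral_add (((hI 2).const_mul _).fun_add (hI1.const_mul _)) (integrable_const _),
      integral_add ((hI 2).const_mul _) (hI1.const_mul _), integral_const_mul, integral_const_mul,
      h1, h2]
    simp only [integral_const, probReal_univ, smul_eq_mul, hF]
    ring
  have hpos : ∀ z y, 0 ≤ x⁻¹ * q ((z - V y) / x) := fun z y =>
    mul_nonneg (inv_nonneg.2 hi.le) (hq0 _)
  have hmain := le_of_lintegral_expDensity_le hp i hi (F := F) (by fun_prop)
    (fun z => by rw [← hval]; exact integral_nonneg (hpos z)) (fun z => by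
      rw [← hval, ofReal_integral_eq_lintegral_ofReal (hint z) (ae_of_all _ (hpos z))]
      refine lintegral_mono fun y => ?_
      rw [expDensity]
      by_cases ht : 0 < z - V y
      · rw [indicator_of_mem (mem_Ioi.2 ht)]
        refine ENNReal.ofReal_le_ofReal ?_
        exact mul_le_mul_of_nonneg_left (exp_neg_le_quadratic (by positivity)) (by positivity)
      · rw [indicator_of_notMem (by simpa using ht)]
        exact zero_le) 0
  refine hmain.trans (le_of_eq ?_)
  simp only [hF]
  field_simp
  ring

lemma le_integral_of_two_coordinates {n : ℕ} {a : Fin (n + 2) → ℝ} {p : ℝ → ℝ}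
    (hp : IsExpSumDensity a p) (i : Fin (n + 2)) (k : Fin (n + 1)) (hi : 0 < a i)
    {H : ℝ → ℝ} (hH : Continuous H) (hH0 : ∀ t, 0 ≤ H t) {C : ℝ} (hC : ∀ t, H t ≤ C)
    (h : ∀ t, ∫⁻ u, expDensity (a i) (t - a (i.succAbove k) * u) ∂(expMeasure 1)
      ≤ ENNReal.ofReal (H t)) :
    p 0 ≤ ∫ y : Fin n → ℝ, H (0 - ∑ j, a (i.succAbove (k.succAbove j)) * y j)
      ∂(Measure.pi fun _ => expMeasure 1) := by
  have hint : ∀ z : ℝ, Integrable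
      (fun y : Fin n → ℝ => H (z - ∑ j, a (i.succAbove (k.succAbove j)) * y j))
      (Measure.pi fun _ => expMeasure 1) := fun z =>
    Integrable.of_bound (C := C) (Continuous.aestronglyMeasurable (by fun_prop))
      (ae_of_all _ fun y => by simpa [abs_of_nonneg (hH0 _)] using hC _)
  refine le_of_lintegral_expDensity_le hp i hi (F := fun z => ∫ y : Fin n → ℝ,
    H (z - ∑ j, a (i.succAbove (k.succAbove j)) * y j) ∂(Measure.pi fun _ => expMeasure 1))
    ?_ (fun z => integral_nonneg fun y => hH0 _) (fun z => ?_) 0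
  · refine continuous_of_dominated (bound := fun _ => C)
      (fun z => (hint z).aestronglyMeasurable) (fun z => ae_of_all _ fun y => ?_)
      (integrable_const _) (ae_of_all _ fun y => by fun_prop)
    simpa [abs_of_nonneg (hH0 _)] using hC _
  · rw [lintegral_pi_succAbove k (by fun_prop),
      ofReal_integral_eq_lintegral_ofReal (hint z) (ae_of_all _ fun y => hH0 _)]
    refine lintegral_mono fun y => ?_
    refine le_trans (le_of_eq (lintegral_congr fun u => ?_)) (h _)
    simp only [Fin.sum_univ_succAbove _ k, Fin.insertNth_apply_same, Fin.insertNth_apply_succAbove]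
    congr 1
    ring

lemma lintegral_expDensity_same_sign {x z : ℝ} (hz : 0 < z) (hzx : z ≤ x) (t : ℝ) :
    ∫⁻ u, expDensity x (t - z * u) ∂(expMeasure 1) ≤ ENNReal.ofReal (z⁻¹ * exp (-1)) := by
  have hx : 0 < x := hz.trans_le hzx
  rw [lintegral_expMeasure (by fun_prop)]
  calc _ ≤ ∫⁻ u in Ioi (0 : ℝ), (Ioc 0 (t / z)).indicator
        (fun _ => ENNReal.ofReal (x⁻¹ * exp (-(t / x)))) u := by
        refine setLIntegral_mono' measurableSet_Ioi fun u hu => ?_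
        have hu : 0 < u := hu
        rw [expDensity]
        by_cases ht : 0 < t - z * u
        · have hmem : u ∈ Ioc 0 (t / z) := ⟨hu, by rw [le_div_iff₀ hz]; linarith⟩
          rw [indicator_of_mem (mem_Ioi.2 ht), indicator_of_mem hmem,
            ← ENNReal.ofReal_mul (exp_pos _).le]
          refine ENNReal.ofReal_le_ofReal ?_
          rw [mul_left_comm, ← exp_add]
          gcongr
          have : (t - z * u) / x = t / x - z / x * u := by ring
          rw [this]
          have : z / x ≤ 1 := (div_le_one hx).2 hzx
          nlinarith
        · rw [indicator_of_notMem (by simpa using ht)]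
          simp
    _ ≤ ∫⁻ u, (Ioc 0 (t / z)).indicator
        (fun _ => ENNReal.ofReal (x⁻¹ * exp (-(t / x)))) u := setLIntegral_le_lintegral _ _
    _ ≤ _ := by
        rw [lintegral_indicator measurableSet_Ioc, setLIntegral_const, Real.volume_Ioc,
          ← ENNReal.ofReal_mul (by positivity)]
        refine ENNReal.ofReal_le_ofReal ?_
        have h := add_one_le_exp (t / x - 1)
        have h2 : exp (t / x - 1) * exp (-(t / x)) = exp (-1) := by rw [← exp_add]; ring_nf
        calc x⁻¹ * exp (-(t / x)) * (t / z - 0)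
            = z⁻¹ * ((t / x - 1 + 1) * exp (-(t / x))) := by field_simp; ring
          _ ≤ z⁻¹ * (exp (t / x - 1) * exp (-(t / x))) := by gcongr
          _ = _ := by rw [h2]

lemma lintegral_expDensity_opposite_sign {x y : ℝ} (hy : 0 < y) (hyx : y ≤ x) (t : ℝ) :
    ∫⁻ u, expDensity x (t - -y * u) ∂(expMeasure 1)
      ≤ ENNReal.ofReal ((x + y)⁻¹ * exp (-(|t| / x))) := by
  have hx : 0 < x := hy.trans_le hyx
  set c := max 0 (-t / y) with hc
  have hneg : -(1 + y / x) < 0 := by have : 0 < y / x := by positivity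
                                     linarith
  have hint : IntegrableOn (fun u => x⁻¹ * exp (-(t / x)) * exp (-(1 + y / x) * u)) (Ioi c) :=
    (integrableOn_exp_mul_Ioi hneg c).const_mul _
  rw [lintegral_expMeasure (by fun_prop)]
  calc _ ≤ ∫⁻ u in Ioi (0 : ℝ), (Ioi c).indicator
        (fun u => ENNReal.ofReal (x⁻¹ * exp (-(t / x)) * exp (-(1 + y / x) * u))) u := by
        refine setLIntegral_mono' measurableSet_Ioi fun u hu => ?_
        have hu : 0 < u := hu
        rw [expDensity]
        by_cases ht : 0 < t - -y * u
        · have hmem : u ∈ Ioi c := by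
            rw [mem_Ioi, hc, max_lt_iff]
            exact ⟨hu, by rw [div_lt_iff₀ hy]; linarith⟩
          rw [indicator_of_mem (mem_Ioi.2 ht), indicator_of_mem hmem,
            ← ENNReal.ofReal_mul (exp_pos _).le, mul_left_comm, ← exp_add, mul_assoc, ← exp_add]
          refine le_of_eq ?_
          congr 3
          ring
        · rw [indicator_of_notMem (by simpa using ht)]
          simp
    _ ≤ ∫⁻ u, (Ioi c).indicator
        (fun u => ENNReal.ofReal (x⁻¹ * exp (-(t / x)) * exp (-(1 + y / x) * u))) u :=
        setLIntegral_le_lintegral _ _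
    _ ≤ _ := by
        rw [lintegral_indicator measurableSet_Ioi, ← ofReal_integral_eq_lintegral_ofReal hint
          (ae_of_all _ fun u => by positivity), integral_const_mul, integral_exp_mul_Ioi hneg]
        refine ENNReal.ofReal_le_ofReal ?_
        have : x⁻¹ * exp (-(t / x)) * (-exp (-(1 + y / x) * c) / -(1 + y / x))
            = (x + y)⁻¹ * exp (-(t / x) + -(1 + y / x) * c) := by
          rw [exp_add]; field_simp
        rw [this]
        gcongr
        rcases le_total 0 t with h | h
        · rw [abs_of_nonneg h]
          have : 0 ≤ c := le_max_left _ _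
          nlinarith
        · rw [abs_of_nonpos h]
          have h1 : -t / y ≤ c := le_max_right _ _
          have h2 : (-t) / x ≤ (-t) / y := div_le_div_of_nonneg_left (by linarith) hy hyx
          have h3 : (1 + y / x) * (-t / y) = -t / y + (-t) / x := by field_simp; ring
          have h4 : (1 + y / x) * (-t / y) ≤ (1 + y / x) * c := by
            apply mul_le_mul_of_nonneg_left h1; linarith
          have h5 : -(t / x) = -t / x := by ring
          linarith

lemma le_of_same_sign {n : ℕ} {a : Fin (n + 2) → ℝ} {p : ℝ → ℝ} (hp : IsExpSumDensity a p)
    (i : Fin (n + 2)) (k : Fin (n + 1)) (hk : 0 < a (i.succAbove k))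
    (hik : a (i.succAbove k) ≤ a i) : p 0 ≤ (a (i.succAbove k))⁻¹ * exp (-1) := by
  have h := le_integral_of_two_coordinates hp i k (hk.trans_le hik)
    (H := fun _ => (a (i.succAbove k))⁻¹ * exp (-1)) continuous_const
    (fun _ => by positivity) (fun _ => le_rfl) (lintegral_expDensity_same_sign hk hik)
  simpa using h

lemma integral_exp_neg_abs_le {n : ℕ} (a : Fin n → ℝ) {x s : ℝ} (hx : 0 < x) (hs : 0 ≤ s)
    (hs2 : s ^ 2 = ∑ j, a j ^ 2 + (∑ j, a j) ^ 2) :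
    ∫ y : Fin n → ℝ, exp (-(|∑ j, a j * y j| / x)) ∂(Measure.pi fun _ => expMeasure 1)
      ≤ 1 - 2 / 7 * (s / x) + (s / x) ^ 2 / 2 := by
  obtain ⟨hI, -, h2, h4⟩ := linear_moments a
  rw [← hs2] at h2 h4
  set P : Measure (Fin n → ℝ) := Measure.pi fun _ => expMeasure 1 with hP
  set V : (Fin n → ℝ) → ℝ := fun y => ∑ j, a j * y j with hV
  replace hI : ∀ k : ℕ, Integrable (fun y => V y ^ k) P := hI
  replace h2 : ∫ y, V y ^ 2 ∂P = s ^ 2 := h2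
  replace h4 : ∫ y, V y ^ 4 ∂P ≤ 49 / 4 * (s ^ 2) ^ 2 := h4
  have hVc : Continuous V := by fun_prop
  have hint : Integrable (fun y => exp (-(|V y| / x))) P :=
    Integrable.of_bound (C := 1) (Continuous.aestronglyMeasurable (by fun_prop))
      (ae_of_all _ fun y => by
        rw [norm_of_nonneg (exp_pos _).le, exp_le_one_iff]
        exact neg_nonpos.2 (by positivity))
  rcases hs.eq_or_lt with rfl | hs
  · calc _ ≤ ∫ y, (1 : ℝ) ∂P := integral_mono hint (integrable_const _) fun y => by
          simp only [exp_le_one_iff]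
          exact neg_nonpos.2 (by positivity)
      _ ≤ _ := by simp
  have hpt : ∀ y, exp (-(|V y| / x)) ≤ 4 / (343 * s ^ 3 * x) * V y ^ 4
      + (1 / (2 * x ^ 2) - 3 / (7 * s * x)) * V y ^ 2 + 1 := by
    intro y
    have h := exp_neg_le_one_sub_add (u := |V y| / x) (by positivity)
    set w := |V y| with hw
    have hw0 : 0 ≤ w := abs_nonneg _
    have e2 : V y ^ 2 = w ^ 2 := (sq_abs _).symm
    have e4 : V y ^ 4 = w ^ 4 := by rw [show (4 : ℕ) = 2 * 2 by norm_num, pow_mul, e2, pow_mul]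
    have hk : 0 ≤ w * (w - 7 / 2 * s) ^ 2 * (w + 7 * s) * (4 / (343 * s ^ 3 * x)) := by positivity
    have hk2 : w * (w - 7 / 2 * s) ^ 2 * (w + 7 * s) * (4 / (343 * s ^ 3 * x))
        = 4 / (343 * s ^ 3 * x) * w ^ 4 - 3 / (7 * s * x) * w ^ 2 + w / x := by
      field_simp; ring
    have hk3 : (w / x) ^ 2 / 2 = 1 / (2 * x ^ 2) * w ^ 2 := by field_simp
    rw [e2, e4]
    linarith
  calc _ ≤ ∫ y, (4 / (343 * s ^ 3 * x) * V y ^ 4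
      + (1 / (2 * x ^ 2) - 3 / (7 * s * x)) * V y ^ 2 + 1) ∂P :=
        integral_mono hint ((((hI 4).const_mul _).add ((hI 2).const_mul _)).add
          (integrable_const _)) hpt
    _ = 4 / (343 * s ^ 3 * x) * ∫ y, V y ^ 4 ∂P
      + (1 / (2 * x ^ 2) - 3 / (7 * s * x)) * s ^ 2 + 1 := by
        rw [integral_add (((hI 4).const_mul _).fun_add ((hI 2).const_mul _)) (integrable_const _),
          integral_add ((hI 4).const_mul _) ((hI 2).const_mul _), integral_const_mul,
          integral_const_mul, h2]
        simp
    _ ≤ 4 / (343 * s ^ 3 * x) * (49 / 4 * (s ^ 2) ^ 2)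
      + (1 / (2 * x ^ 2) - 3 / (7 * s * x)) * s ^ 2 + 1 := by gcongr
    _ = _ := by field_simp; ring

lemma le_of_opposite_sign {n : ℕ} {a : Fin (n + 2) → ℝ} {p : ℝ → ℝ} (hp : IsExpSumDensity a p)
    (i : Fin (n + 2)) (k : Fin (n + 1)) {x y s : ℝ} (hx : a i = x) (hy : a (i.succAbove k) = -y)
    (hy0 : 0 < y) (hyx : y ≤ x) (hs : 0 ≤ s)
    (hs2 : s ^ 2 = ∑ j, a (i.succAbove (k.succAbove j)) ^ 2
      + (∑ j, a (i.succAbove (k.succAbove j))) ^ 2) :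
    p 0 ≤ (x + y)⁻¹ * (1 - 2 / 7 * (s / x) + (s / x) ^ 2 / 2) := by
  have hx0 : 0 < x := hy0.trans_le hyx
  have h := le_integral_of_two_coordinates hp i k (hx ▸ hx0)
    (H := fun t => (x + y)⁻¹ * exp (-(|t| / x))) (by fun_prop)
    (fun _ => by positivity) (C := (x + y)⁻¹ * 1) (fun t => by
      gcongr
      rw [exp_le_one_iff]
      exact neg_nonpos.2 (by positivity)) (by
      rw [hx, hy]; exact lintegral_expDensity_opposite_sign hy0 hyx)
  simp only [zero_sub, abs_neg] at h
  rw [integral_const_mul] at h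
  refine h.trans ?_
  gcongr
  exact integral_exp_neg_abs_le _ hx0 hs hs2

lemma quadratic_le_prod_one_add {ι : Type*} (s : Finset ι) {b : ι → ℝ} (hb : ∀ j, 0 ≤ b j) :
    ∑ j ∈ s, b j ^ 2 ≤ (∑ j ∈ s, b j) ^ 2 ∧
      1 + ∑ j ∈ s, b j + ((∑ j ∈ s, b j) ^ 2 - ∑ j ∈ s, b j ^ 2) / 2 ≤ ∏ j ∈ s, (1 + b j) := by
  classical
  induction s using Finset.induction_on with
  | empty => simp
  | insert i s hi ih =>
    rw [Finset.sum_insert hi, Finset.sum_insert hi, Finset.prod_insert hi]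
    have hs : 0 ≤ ∑ j ∈ s, b j := Finset.sum_nonneg fun j _ => hb j
    refine ⟨by nlinarith [mul_nonneg (hb i) hs, ih.1], ?_⟩
    refine le_trans ?_ (mul_le_mul_of_nonneg_left ih.2 (by linarith [hb i]))
    nlinarith [mul_nonneg (hb i) (sub_nonneg.2 ih.1)]

lemma integral_cexp_expMeasure (s : ℝ) :
    ∫ x : ℝ, Complex.exp (-(s * x : ℝ) * Complex.I) ∂(expMeasure 1) = (1 + s * Complex.I)⁻¹ := by
  rw [integral_expMeasure]
  have h := integral_exp_mul_complex_Ioi (a := -(1 + s * Complex.I)) (by simp) 0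
  have h2 : ∀ x : ℝ, exp (-x) • Complex.exp (-(s * x : ℝ) * Complex.I)
      = Complex.exp (-(1 + s * Complex.I) * x) := by
    intro x
    rw [Complex.real_smul, Complex.ofReal_exp, ← Complex.exp_add]
    congr 1
    push_cast
    ring
  simp_rw [h2]
  rw [h, Complex.ofReal_zero, mul_zero, Complex.exp_zero, neg_div_neg_eq, one_div]

lemma fourier_eq_prod {n : ℕ} {a : Fin n → ℝ} {p : ℝ → ℝ} (hp : IsExpSumDensity a p) (ξ : ℝ) :
    𝓕 (fun x => ((max (p x) 0 : ℝ) : ℂ)) ξ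
      = ∏ j, (1 + (2 * π * ξ * a j : ℝ) * Complex.I)⁻¹ := by
  have hpc := hp.1
  rw [fourier_real_eq_integral_exp_smul]
  calc _ = ∫ v : ℝ, Complex.exp (-(2 * π * ξ * v : ℝ) * Complex.I)
        ∂(volume.withDensity fun x => ENNReal.ofReal (p x)) := by
        rw [integral_withDensity_eq_integral_toReal_smul (by fun_prop) (by simp)]
        congr 1
        ext v
        rw [ENNReal.toReal_ofReal', Complex.real_smul, smul_eq_mul, mul_comm]
        congr 3
        push_cast
        ring
    _ = ∫ x : Fin n → ℝ, ∏ j, Complex.exp (-(2 * π * ξ * a j * x j : ℝ) * Complex.I)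
        ∂(Measure.pi fun _ => expMeasure 1) := by
        rw [← hp.2, integral_map
          (Measurable.aemeasurable (by fun_prop)) (Continuous.aestronglyMeasurable (by fun_prop))]
        congr 1
        ext x
        rw [← Complex.exp_sum, ← Finset.sum_mul]
        congr 2
        push_cast
        rw [Finset.mul_sum, ← Finset.sum_neg_distrib]
        exact Finset.sum_congr rfl fun j _ => by ring
    _ = _ := by
        rw [integral_fintype_prod_eq_prod
          (fun j (x : ℝ) => Complex.exp (-(2 * π * ξ * a j * x : ℝ) * Complex.I))]
        exact Finset.prod_congr rfl fun j _ => integral_cexp_expMeasure _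

lemma integrable_max_zero {n : ℕ} {a : Fin n → ℝ} {p : ℝ → ℝ} (hp : IsExpSumDensity a p) :
    Integrable fun x => max (p x) 0 := by
  have hpc := hp.1
  have h : ∫⁻ x, ENNReal.ofReal (p x) ≠ ∞ := by
    have h := congrArg (fun μ => μ univ) hp.2
    simp only [withDensity_apply _ MeasurableSet.univ, Measure.restrict_univ] at h
    rw [← h]
    rw [Measure.map_apply (by fun_prop) MeasurableSet.univ]
    simp
  have := integrable_toReal_of_lintegral_ne_top (by fun_prop) h
  simpa only [ENNReal.toReal_ofReal'] using this

/-- The function `u ↦ 2 / (1 + u²)² - 1 / (1 + u²)` has a bounded primitive with equal limits. -/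
lemma integral_two_mul_inv_sq_sub_inv :
    Integrable (fun u : ℝ => 2 * (1 + u ^ 2)⁻¹ ^ 2 - (1 + u ^ 2)⁻¹) ∧
      ∫ u : ℝ, (2 * (1 + u ^ 2)⁻¹ ^ 2 - (1 + u ^ 2)⁻¹) = 0 := by
  have hpos : ∀ u : ℝ, 0 < 1 + u ^ 2 := fun u => by positivity
  have hint : Integrable (fun u : ℝ => 2 * (1 + u ^ 2)⁻¹ ^ 2 - (1 + u ^ 2)⁻¹) := by
    refine integrable_inv_one_add_sq.mono' (Measurable.aestronglyMeasurable (by fun_prop))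
      (ae_of_all _ fun u => ?_)
    have h1 : (1 + u ^ 2)⁻¹ ≤ 1 := inv_le_one_of_one_le₀ (by nlinarith [sq_nonneg u])
    have h0 : 0 < (1 + u ^ 2)⁻¹ := inv_pos.2 (hpos u)
    rw [norm_eq_abs, abs_le]
    constructor <;> nlinarith
  refine ⟨hint, ?_⟩
  have hb : ∀ u : ℝ, |u * (1 + u ^ 2)⁻¹| ≤ |u|⁻¹ := by
    intro u
    rcases eq_or_ne u 0 with rfl | hu
    · simp
    rw [abs_mul, abs_of_pos (inv_pos.2 (hpos u)), ← div_eq_mul_inv, div_le_iff₀ (hpos u),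
      ← sq_abs u]
    have : 0 < |u| := abs_pos.2 hu
    field_simp
    linarith
  have ht : Tendsto (fun u : ℝ => u * (1 + u ^ 2)⁻¹) (atBot ⊔ atTop) (𝓝 0) := by
    refine squeeze_zero_norm (a := fun u => |u|⁻¹) hb ?_
    exact tendsto_inv_atTop_zero.comp (tendsto_sup.2 ⟨tendsto_abs_atBot_atTop,
      tendsto_abs_atTop_atTop⟩)
  rw [integral_of_hasDerivAt_of_tendsto (f := fun u => u * (1 + u ^ 2)⁻¹) (fun u => ?_) hint
    (ht.mono_left le_sup_left) (ht.mono_left le_sup_right), sub_zero]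
  have h := (hasDerivAt_id u).mul ((((hasDerivAt_id u).pow 2).const_add 1).inv (hpos u).ne')
  refine h.congr_deriv ?_
  have := (hpos u).ne'
  simp only [id, Pi.inv_apply, Pi.pow_apply]
  field_simp
  ring

lemma inv_le_sq_of_quartic {u q : ℝ} (hq : 1 + 2 * u ^ 2 + 1002 / 1000 * u ^ 4 ≤ q) :
    q⁻¹ ≤ ((1 - 1 / 10000) * (1 + u ^ 2)⁻¹
      + 2 / 10000 * (2 * (1 + u ^ 2)⁻¹ ^ 2 - (1 + u ^ 2)⁻¹)) ^ 2 := by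
  have hA : 0 < 1 + u ^ 2 := by positivity
  have hu4 : 0 ≤ u ^ 4 := by positivity
  have hq0 : 0 < 1 + 2 * u ^ 2 + 1002 / 1000 * u ^ 4 := by positivity
  refine (inv_anti₀ hq0 hq).trans ?_
  rw [inv_le_iff_one_le_mul₀ hq0]
  set r := (1 + u ^ 2)⁻¹ with hr
  have hr0 : 0 < r := inv_pos.2 hA
  have hr1 : r ≤ 1 := inv_le_one_of_one_le₀ (by nlinarith [sq_nonneg u])
  have hAr : r * (1 + u ^ 2) = 1 := inv_mul_cancel₀ hA.ne'
  have hur : r * u ^ 2 = 1 - r := by linarith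
  have hu : r ^ 2 * (1 + 2 * u ^ 2 + 1002 / 1000 * u ^ 4) = 1 + 2 / 1000 * (1 - r) ^ 2 := by
    rw [← hur]
    linear_combination (r * (1 + u ^ 2) + 1) * hAr
  have e : ((1 - 1 / 10000) * r + 2 / 10000 * (2 * r ^ 2 - r)) ^ 2
      * (1 + 2 * u ^ 2 + 1002 / 1000 * u ^ 4)
      = (1 - 3 / 10000 + 4 / 10000 * r) ^ 2 * (1 + 2 / 1000 * (1 - r) ^ 2) := by
    rw [← hu]; ring
  rw [e]
  have hy0 : 0 ≤ (1 - r) ^ 2 := sq_nonneg _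
  have hy1 : (1 - r) ^ 2 ≤ 1 := by nlinarith
  have hm : 1 - 4 / 10000 * (1 - r) ^ 2 ≤ 1 - 3 / 10000 + 4 / 10000 * r := by
    nlinarith [sq_nonneg (2 * r - 1)]
  set y := (1 - r) ^ 2
  have h1 : (1 - 4 / 10000 * y) ^ 2 ≤ (1 - 3 / 10000 + 4 / 10000 * r) ^ 2 :=
    pow_le_pow_left₀ (by linarith) hm 2
  refine le_trans ?_ (mul_le_mul_of_nonneg_right h1 (by positivity))
  nlinarith [mul_nonneg hy0 (sub_nonneg.2 hy1), mul_nonneg hy0 (mul_nonneg hy0 hy0)]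

lemma le_of_sum_pow_four_le {n : ℕ} {a : Fin n → ℝ} {p : ℝ → ℝ} (hp : IsExpSumDensity a p)
    (hsq : ∑ j, a j ^ 2 = 1) (h4 : ∑ j, a j ^ 4 ≤ 499 / 1000) :
    p 0 ≤ (√2)⁻¹ * (1 - 1 / 10000) := by
  set f : ℝ → ℂ := fun x => ((max (p x) 0 : ℝ) : ℂ) with hf
  have hpc := hp.1
  set h : ℝ → ℝ := fun u => (1 - 1 / 10000) * (1 + u ^ 2)⁻¹
      + 2 / 10000 * (2 * (1 + u ^ 2)⁻¹ ^ 2 - (1 + u ^ 2)⁻¹) with hh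
  obtain ⟨hi, hi0⟩ := integral_two_mul_inv_sq_sub_inv
  have hint : Integrable h := (integrable_inv_one_add_sq.const_mul _).add (hi.const_mul _)
  have hval : ∫ u, h u = (1 - 1 / 10000) * π := by
    simp only [hh]
    rw [integral_add (integrable_inv_one_add_sq.const_mul _) (hi.const_mul _), integral_const_mul,
      integral_const_mul, hi0, integral_univ_inv_one_add_sq]
    ring
  have hk : 0 < √2 * π := by positivity
  have hbound : ∀ ξ, ‖𝓕 f ξ‖ ≤ h (√2 * π * ξ) := by
    intro ξ
    have h2 : (√2) ^ 2 = 2 := Real.sq_sqrt (by norm_num)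
    refine abs_le_of_sq_le_sq' (b := h (√2 * π * ξ)) ?_ ?_ |>.2
    · rw [fourier_eq_prod hp, norm_prod, ← Finset.prod_pow]
      simp_rw [norm_inv, inv_pow]
      rw [Finset.prod_inv_distrib]
      refine inv_le_sq_of_quartic ?_
      have e : ∀ j, ‖1 + (2 * π * ξ * a j : ℝ) * Complex.I‖ ^ 2
          = 1 + 2 * (√2 * π * ξ) ^ 2 * a j ^ 2 := by
        intro j
        rw [Complex.sq_norm, ← Complex.ofReal_one, Complex.normSq_add_mul_I]
        linear_combination (- 2 * π ^ 2 * ξ ^ 2 * a j ^ 2) * h2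
      simp_rw [e]
      refine le_trans ?_ (quadratic_le_prod_one_add Finset.univ fun j => by positivity).2
      simp_rw [mul_pow _ (a _ ^ 2), ← Finset.mul_sum, ← pow_mul, hsq]
      set u := √2 * π * ξ
      have hu : 0 ≤ u ^ 4 := by positivity
      norm_num
      nlinarith [mul_le_mul_of_nonneg_left h4 hu]
    · have h0 : 0 < 1 + (√2 * π * ξ) ^ 2 := by positivity
      have h1 : 0 < (1 + (√2 * π * ξ) ^ 2)⁻¹ := inv_pos.2 h0
      simp only [hh]
      nlinarith [sq_nonneg (1 + (√2 * π * ξ) ^ 2)⁻¹]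
  have hcomp : Integrable fun ξ => h (√2 * π * ξ) := hint.comp_mul_left' hk.ne'
  have hF : Integrable (𝓕 f) := by
    refine hcomp.mono' ?_ (ae_of_all _ hbound)
    rw [show 𝓕 f = fun ξ => ∏ j, (1 + (2 * π * ξ * a j : ℝ) * Complex.I)⁻¹ from
      funext (fourier_eq_prod hp)]
    exact Measurable.aestronglyMeasurable (by fun_prop)
  have hinv := congrFun (Continuous.fourierInv_fourier_eq (f := f) (by fun_prop)
    (integrable_max_zero hp).ofReal hF) 0
  rw [fourierInv_eq'] at hinv
  simp only [inner_zero_right, mul_zero, Complex.ofReal_zero, zero_mul, Complex.exp_zero,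
    one_smul] at hinv
  calc p 0 ≤ max (p 0) 0 := le_max_left _ _
    _ = ‖f 0‖ := by
      simp only [hf, Complex.norm_real]
      rw [norm_of_nonneg (le_max_right _ _)]
    _ = ‖∫ ξ, 𝓕 f ξ‖ := by rw [hinv]
    _ ≤ ∫ ξ, h (√2 * π * ξ) := norm_integral_le_of_norm_le hcomp (ae_of_all _ hbound)
    _ = _ := by
      rw [Measure.integral_comp_mul_left, hval, abs_of_pos (inv_pos.2 hk), smul_eq_mul]
      field_simp

lemma inv_mul_le_of_opposite {x y s D : ℝ} (hx : 706 / 1000 ≤ x) (hx2 : x ^ 2 ≤ 58 / 100)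
    (hy : 0 < y) (hs : 0 ≤ s) (hs2 : s ^ 2 = 1 - 2 * (x * y)) (hs3 : s ≤ 232 / 1000)
    (hD : D ^ 2 ≤ 2 - √2 * (x + y)) :
    (x + y)⁻¹ * (1 - 2 / 7 * (s / x) + (s / x) ^ 2 / 2) ≤ (√2)⁻¹ - 2 / 100000 * D := by
  have hx0 : 0 < x := by linarith
  have hxy : 0 < x + y := by linarith
  have hc2 : (√2) ^ 2 = 2 := Real.sq_sqrt (by norm_num)
  have hc0 : 0 < √2 := by positivity
  set c := √2
  have hcu : c ≤ 1415 / 1000 := by nlinarith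
  set β := 1 - c * (x + y) / 2 with hβ
  have hβ0 : 0 ≤ β := by nlinarith [sq_nonneg D]
  have hβ1 : β ≤ 1 := by have := mul_pos hc0 hxy; linarith
  have hβs : β * (2 - β) ≤ s ^ 2 := by
    have : (1 - β) ^ 2 = (x + y) ^ 2 / 2 := by
      rw [hβ]; linear_combination (x + y) ^ 2 / 4 * hc2
    nlinarith [sq_nonneg (x - y)]
  have hs4 : s ^ 2 ≤ 54 / 1000 := by nlinarith
  have hβ2 : β ≤ 54 / 1000 := by nlinarith
  have hβ3 : β ≤ 516 / 1000 * s ^ 2 := by nlinarith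
  have hDs : D ≤ 102 / 100 * s := abs_le_of_sq_le_sq' (by nlinarith) (by positivity) |>.2
  have hxyc : x + y ≤ c := by nlinarith
  rw [inv_mul_le_iff₀ hxy]
  have hinv : (x + y) * c⁻¹ = 1 - β := by
    have : c⁻¹ = c / 2 := by field_simp; linarith
    rw [this, hβ]; ring
  have hDxy : (x + y) * (2 / 100000 * D) ≤ 3 / 100000 * s := by
    calc (x + y) * (2 / 100000 * D) ≤ (x + y) * (2 / 100000 * (102 / 100 * s)) := by gcongr
      _ ≤ 1415 / 1000 * (2 / 100000 * (102 / 100 * s)) := by gcongr; linarith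
      _ ≤ _ := by nlinarith
  rw [mul_sub, hinv]
  have key : 516 / 1000 * s ^ 2 + 3 / 100000 * s ≤ 2 / 7 * (s / x) - (s / x) ^ 2 / 2 := by
    have e : 2 / 7 * (s / x) - (s / x) ^ 2 / 2 = s * (2 / 7 * x - s / 2) / x ^ 2 := by
      field_simp
    rw [e, le_div_iff₀ (by positivity)]
    have : (516 / 1000 * s + 3 / 100000) * x ^ 2 ≤ 2 / 7 * x - s / 2 := by
      have := mul_le_mul_of_nonneg_left hx2 (show 0 ≤ 516 / 1000 * s + 3 / 100000 by positivity)
      linarith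
    calc (516 / 1000 * s ^ 2 + 3 / 100000 * s) * x ^ 2
        = s * ((516 / 1000 * s + 3 / 100000) * x ^ 2) := by ring
      _ ≤ _ := mul_le_mul_of_nonneg_left this hs
  linarith

lemma le_mul_of_fourth_moment {v w : ℝ} (hv1 : 499 / 1000 ≤ v) (hv : v ≤ 58 / 100)
    (h : 499 / 1000 ≤ v ^ 2 + w * (1 - v)) : 36 / 100 ≤ w ∧ 224 / 1000 ≤ v * w := by
  have hv0 : 0 < 1 - v := by linarith
  have h2 : 0 ≤ (v - 499 / 1000) * (58 / 100 - v) :=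
    mul_nonneg (by linarith) (by linarith)
  constructor
  · refine le_of_mul_le_mul_right ?_ hv0
    nlinarith
  · refine le_of_mul_le_mul_right ?_ hv0
    have h3 : v * (499 / 1000) ≤ v * (v ^ 2 + w * (1 - v)) :=
      mul_le_mul_of_nonneg_left h (by linarith)
    have h4 : 0 ≤ (v - 499 / 1000) * (58 / 100 - v) * (v + 1079 / 1000) :=
      mul_nonneg h2 (by linarith)
    linarith

lemma le_of_max_sq_of_pos {n : ℕ} {a : Fin (n + 1) → ℝ} {p : ℝ → ℝ} (hp : IsExpSumDensity a p)
    (hsum : ∑ j, a j = 0) (hsq : ∑ j, a j ^ 2 = 1) {D : ℝ}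
    (hD : ∀ i k, D ^ 2 ≤ 2 - √2 * (a i - a k)) (i : Fin (n + 1))
    (hmax : ∀ j, a j ^ 2 ≤ a i ^ 2) (hi : 0 < a i) :
    p 0 ≤ (√2)⁻¹ - 2 / 100000 * D := by
  rcases n with - | n
  · simp only [Nat.reduceAdd, Finset.univ_unique, Finset.sum_singleton] at hsum hsq
    rw [hsum] at hsq
    norm_num at hsq
  have hc2 : (√2) ^ 2 = 2 := Real.sq_sqrt (by norm_num)
  have hc0 : 0 < √2 := by positivity
  have hcu : √2 ≤ 141422 / 100000 := by nlinarith
  have hinv : (√2)⁻¹ = √2 / 2 := by field_simp; linarith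
  have hcl : 141421 / 100000 ≤ √2 := by nlinarith
  have hDu : D ≤ √2 := by
    have := hD i i
    rw [sub_self, mul_zero, sub_zero, ← hc2] at this
    exact abs_le_of_sq_le_sq' this hc0.le |>.2
  have htarget : 70707 / 100000 ≤ (√2)⁻¹ - 2 / 100000 * D := by
    rw [hinv]; linarith
  by_cases h4 : ∑ j, a j ^ 4 ≤ 499 / 1000
  · refine (le_of_sum_pow_four_le hp hsq h4).trans ?_
    rw [hinv]; linarith
  rw [not_le] at h4
  obtain ⟨k, hk⟩ := Finite.exists_max fun j => a (i.succAbove j) ^ 2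
  have hki := hmax (i.succAbove k)
  have hsq' := hsq
  have hsum' := hsum
  rw [Fin.sum_univ_succAbove _ i] at hsq hsum h4
  have hrest : ∑ j, a (i.succAbove j) ^ 4
      ≤ a (i.succAbove k) ^ 2 * ∑ j, a (i.succAbove j) ^ 2 := by
    rw [Finset.mul_sum]
    refine Finset.sum_le_sum fun j _ => ?_
    nlinarith [mul_le_mul_of_nonneg_right (hk j) (sq_nonneg (a (i.succAbove j)))]
  have hfour : 499 / 1000 < (a i ^ 2) ^ 2 + a (i.succAbove k) ^ 2 * (1 - a i ^ 2) := by
    have : ∑ j, a (i.succAbove j) ^ 2 = 1 - a i ^ 2 := by linarith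
    rw [this] at hrest
    nlinarith
  have hwle : a (i.succAbove k) ^ 2 ≤ 1 - a i ^ 2 := by
    have := Finset.single_le_sum (f := fun j => a (i.succAbove j) ^ 2)
      (fun j _ => sq_nonneg _) (Finset.mem_univ k)
    linarith
  rw [Fin.sum_univ_succAbove _ k] at hsq hsum
  have hDik := hD i (i.succAbove k)
  have hone := le_of_one_coordinate hp hsum' hsq' i hi
  have hsame := le_of_same_sign hp i k
  have hopp := fun y s => le_of_opposite_sign hp i k (x := a i) (y := y) (s := s) rfl
  set x := a i with hx
  set z := a (i.succAbove k) with hz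
  by_cases hv : 58 / 100 ≤ x ^ 2
  · refine hone.trans (le_trans ?_ htarget)
    have hx1 : 76 / 100 ≤ x :=
      abs_le_of_sq_le_sq' (by norm_num1; linarith) hi.le |>.2
    have hx2 : x⁻¹ ^ 2 ≤ 100 / 58 := by
      rw [inv_pow, inv_le_comm₀ (by positivity) (by norm_num)]
      linarith
    rw [inv_mul_le_iff₀ hi]
    nlinarith
  rw [not_le] at hv
  have hv1 : 499 / 1000 ≤ x ^ 2 := by
    have := mul_le_mul_of_nonneg_right hki (show 0 ≤ 1 - x ^ 2 by linarith)
    linarith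
  obtain ⟨hw1, hvw⟩ := le_mul_of_fourth_moment hv1 hv.le hfour.le
  rcases lt_trichotomy z 0 with hz0 | hz0 | hz0
  · have hxl : 706 / 1000 ≤ x :=
      abs_le_of_sq_le_sq' (by norm_num1; linarith) hi.le |>.2
    have hzx : -z ≤ x := abs_le_of_sq_le_sq' (by rwa [neg_sq]) hi.le |>.2
    have hxz : 4732 / 10000 ≤ x * -z := by
      refine abs_le_of_sq_le_sq' (a := 4732 / 10000) (b := x * -z) ?_ ?_ |>.2
      · rw [mul_pow, neg_sq]; linarith
      · exact mul_nonneg hi.le (by linarith)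
    set s := √(∑ j, a (i.succAbove (k.succAbove j)) ^ 2
      + (∑ j, a (i.succAbove (k.succAbove j))) ^ 2) with hsdef
    have hs2 : s ^ 2 = ∑ j, a (i.succAbove (k.succAbove j)) ^ 2
      + (∑ j, a (i.succAbove (k.succAbove j))) ^ 2 := Real.sq_sqrt (by positivity)
    have hs0 : 0 ≤ s := Real.sqrt_nonneg _
    refine (hopp (-z) s (neg_neg z).symm (by linarith) hzx hs0 hs2).trans ?_
    have hs2' : s ^ 2 = 1 - 2 * (x * -z) := by
      have h1 : ∑ j, a (i.succAbove (k.succAbove j)) = -x - z := by linarith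
      have h2 : ∑ j, a (i.succAbove (k.succAbove j)) ^ 2 = 1 - x ^ 2 - z ^ 2 := by linarith
      rw [hs2, h1, h2]; ring
    have hs3 : s ≤ 232 / 1000 :=
      abs_le_of_sq_le_sq' (by norm_num1; linarith) (by norm_num1) |>.2
    refine inv_mul_le_of_opposite hxl hv.le (by linarith) hs0 hs2' hs3 ?_
    rwa [← sub_eq_add_neg]
  · rw [hz0] at hw1
    norm_num at hw1
  · have hzx : z ≤ x := abs_le_of_sq_le_sq' hki hi.le |>.2
    have hz1 : 6 / 10 ≤ z :=
      abs_le_of_sq_le_sq' (by norm_num1; linarith) hz0.le |>.2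
    refine (hsame hz0 hzx).trans (le_trans ?_ htarget)
    rw [inv_mul_le_iff₀ hz0]
    have := Real.exp_neg_one_lt_d9
    nlinarith

lemma neg_density {n : ℕ} {a : Fin n → ℝ} {p : ℝ → ℝ} (hp : IsExpSumDensity a p) :
    IsExpSumDensity (fun j => -a j) fun t => p (-t) := by
  have hpc := hp.1
  refine ⟨by fun_prop, ?_⟩
  have h : (fun x : Fin n → ℝ => ∑ j, -a j * x j) = Neg.neg ∘ fun x => ∑ j, a j * x j := by
    ext x; simp
  rw [h, ← Measure.map_map measurable_neg (by fun_prop), hp.2]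
  ext s hs
  rw [Measure.map_apply measurable_neg hs, withDensity_apply _ (measurable_neg hs),
    withDensity_apply _ hs]
  exact (Measure.measurePreserving_neg volume).setLIntegral_comp_preimage_emb
    (MeasurableEquiv.neg ℝ).measurableEmbedding (fun x => ENNReal.ofReal (p (-x))) s
      |>.symm ▸ by simp

lemma le_of_forall_sq_le {n : ℕ} {a : Fin (n + 1) → ℝ} {p : ℝ → ℝ} (hp : IsExpSumDensity a p)
    (hsum : ∑ j, a j = 0) (hsq : ∑ j, a j ^ 2 = 1) {D : ℝ}
    (hD : ∀ i k, D ^ 2 ≤ 2 - √2 * (a i - a k)) :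
    p 0 ≤ (√2)⁻¹ - 2 / 100000 * D := by
  obtain ⟨i, hi⟩ := Finite.exists_max fun j => a j ^ 2
  rcases lt_trichotomy (a i) 0 with h | h | h
  · have := le_of_max_sq_of_pos (neg_density hp) (D := D) (by simpa using hsum)
      (by simpa using hsq) (fun i k => by simpa [add_comm, sub_eq_add_neg] using hD k i) i
      (by simpa using hi)
      (by linarith)
    simpa using this
  · have h0 : ∑ j, a j ^ 2 ≤ ∑ j : Fin (n + 1), (0 : ℝ) :=
      Finset.sum_le_sum fun j _ => (hi j).trans (by simp [h])
    rw [hsq] at h0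
    norm_num at h0
  · exact le_of_max_sq_of_pos hp hsum hsq hD i hi h

end SimplexSlicing

/-- **Stability of simplex slicing, uniform form.**
Let `a = (a₁, ..., a_{n+1})` be a unit vector in `ℝ^{n+1}` with `∑ aⱼ = 0` and
`a₁ ≥ a₂ ≥ ... ≥ a_{n+1}`. Set `δ(a) = |a - (e₁ - e_{n+1})/√2|²`. Then
`p_a(0) ≤ 1/√2 - 2⬝10⁻⁵ √δ(a)`. -/
theorem simplex_slicing_stability_uniform (n : ℕ) (hn : 1 ≤ n)
    (a : EuclideanSpace ℝ (Fin (n + 1))) (hnorm : ‖a‖ = 1)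
    (hsum : ∑ j, a j = 0) (hmono : ∀ i j : Fin (n + 1), i ≤ j → a j ≤ a i)
    (p : ℝ → ℝ) (hp : IsExpSumDensity (fun j => a j) p)
    (δ : ℝ)
    (hδ : δ = ‖a - (Real.sqrt 2)⁻¹ •
        (EuclideanSpace.single (0 : Fin (n + 1)) (1 : ℝ)
          - EuclideanSpace.single (Fin.last n) (1 : ℝ))‖ ^ 2) :
    p 0 ≤ (Real.sqrt 2)⁻¹ - (2 / 100000) * Real.sqrt δ := by
  have hsq : ∑ j, a j ^ 2 = 1 := by
    rw [← EuclideanSpace.real_norm_sq_eq, hnorm, one_pow]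
  have hne : Fin.last n ≠ 0 := Fin.ne_of_val_ne (by simp; lia)
  have hδ' : δ = 2 - √2 * (a 0 - a (Fin.last n)) := by
    have hc2 : (√2) ^ 2 = 2 := Real.sq_sqrt (by norm_num)
    have hinv : (√2)⁻¹ = √2 / 2 := by field_simp; linarith
    rw [hδ, @norm_sub_sq_real, hnorm, inner_smul_right, inner_sub_right,
      EuclideanSpace.inner_single_right, EuclideanSpace.inner_single_right, norm_smul, mul_pow,
      @norm_sub_sq_real, EuclideanSpace.inner_single_right, PiLp.norm_single,
      PiLp.norm_single]
    simp [hne, hc2]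
    rw [hinv]
    ring
  have hδ0 : 0 ≤ δ := hδ ▸ by positivity
  refine SimplexSlicing.le_of_forall_sq_le hp hsum hsq fun i k => ?_
  rw [Real.sq_sqrt hδ0, hδ']
  have h1 := hmono 0 i (Fin.zero_le i)
  have h2 := hmono k (Fin.last n) (Fin.le_last k)
  gcongr
end
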